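/- arXiv:2503.04503 — 5 statements merged into one kernel-verified Lean document; each statement's English description precedes it below -/
import Mathlib

section
/- Let V be a finite set, let W : V × V → ℝ be symmetric, nonnegative, with zero diagonal, and assume the graph on V whose edges are the pairs {i,j} with W_{ij} > 0 is connected. For x ∈ V and u : V → ℝ with u_x = 0, define the mixing density ρ^{W,1}_x(u) = exp(−(1/2) Σ_{{i,j}} W_{ij}(e^{u_i−u_j} + e^{u_j−u_i} − 2)) · √(D(W,u)) · ∏_{i∈V∖{x}} e^{−u_i}/√(2π), where D(W,u) = Σ_T ∏_{{i,j}∈E(T)} W_{ij} e^{u_i+u_j} (sum over all spanning trees T of the complete graph on V) and Σ_{{i,j}} runs over unordered pairs of distinct vertices. Then for all a, b ∈ V and all u : V → ℝ with u_a = 0, setting u'_i = u_i − u_b for all i (so u'_b = 0), one has e^{u_b − u_a} · ρ^{W,1}_a(u) = ρ^{W,1}_b(u'). -/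
/-- The set of (edge sets of) spanning trees of the complete graph on `V`,
i.e. all trees with vertex set `V`, encoded by their edge sets. -/
noncomputable def spanningTrees (V : Type*) [Fintype V] [DecidableEq V] :
    Finset (Finset (Sym2 V)) := by
  classical
  exact Finset.univ.filter fun T =>
    (SimpleGraph.fromEdgeSet (↑T : Set (Sym2 V))).IsTree ∧ ∀ e ∈ T, ¬ e.IsDiag

/-- The spanning-tree generating polynomial `∑_T ∏_{e ∈ T} f e`. -/
noncomputable def treePoly {V : Type*} [Fintype V] [DecidableEq V] (f : Sym2 V → ℝ) : ℝ :=
  ∑ T ∈ spanningTrees V, ∏ e ∈ T, f e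

/-- `D(W,u) = ∑_T ∏_{{i,j} ∈ E(T)} W i j * exp (u i + u j)`, the sum ranging over
all spanning trees of the complete graph on `V`. -/
noncomputable def treeGen {V : Type*} [Fintype V] [DecidableEq V]
    (W : V → V → ℝ) (u : V → ℝ) (hW : ∀ i j, W i j = W j i) : ℝ :=
  treePoly (Sym2.lift ⟨fun i j => W i j * Real.exp (u i + u j),
    fun i j => by simp [hW i j, add_comm]⟩)

/-- Sum over unordered pairs of distinct vertices: for a symmetric summand `f`,
this equals `Σ_{{i,j}} f i j` (half the sum over ordered pairs of distinct vertices). -/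
noncomputable def pairSum {V : Type*} [Fintype V] [DecidableEq V] (f : V → V → ℝ) : ℝ :=
  (1 / 2) * ∑ p ∈ Finset.univ.offDiag, f p.1 p.2

/-- The mixing density `ρ^{W,ϑ}_x(u)` of the Vertex Reinforced Jump Process. -/
noncomputable def mixDensity {V : Type*} [Fintype V] [DecidableEq V]
    (W : V → V → ℝ) (hW : ∀ i j, W i j = W j i) (ϑ : V → ℝ) (x : V) (u : V → ℝ) : ℝ :=
  Real.exp (-(1 / 2) * pairSum (fun i j =>
      W i j * (Real.exp (u i - u j) * ϑ j ^ 2 + Real.exp (u j - u i) * ϑ i ^ 2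
        - 2 * (ϑ i * ϑ j))))
  * Real.sqrt (treeGen W u hW)
  * ∏ i ∈ Finset.univ.filter (fun i => i ≠ x), (ϑ i * Real.exp (-u i) / Real.sqrt (2 * Real.pi))

/-- Every spanning tree on `V` has `|V| - 1` edges. -/
lemma card_of_mem_spanningTrees {V : Type*} [Fintype V] [DecidableEq V] {T : Finset (Sym2 V)}
    (hT : T ∈ spanningTrees V) : T.card = Fintype.card V - 1 := by
  classical
  simp only [spanningTrees, Finset.mem_filter, Finset.mem_univ, true_and] at hT
  obtain ⟨htree, hdiag⟩ := hT
  have hedges : (SimpleGraph.fromEdgeSet (↑T : Set (Sym2 V))).edgeFinset = T := by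
    ext e
    simpa using fun he => hdiag e he
  have hcard := htree.card_edgeFinset
  rw [hedges] at hcard
  omega

/-- The spanning-tree polynomial is homogeneous of degree `|V| - 1`. -/
lemma treePoly_const_mul {V : Type*} [Fintype V] [DecidableEq V] (c : ℝ) (f : Sym2 V → ℝ) :
    treePoly (fun e => c * f e) = c ^ (Fintype.card V - 1) * treePoly f := by
  rw [treePoly, treePoly, Finset.mul_sum]
  refine Finset.sum_congr rfl fun T hT => ?_
  rw [Finset.prod_mul_distrib, Finset.prod_const, card_of_mem_spanningTrees hT]

lemma treeGen_sub_const {V : Type*} [Fintype V] [DecidableEq V]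
    (W : V → V → ℝ) (hW : ∀ i j, W i j = W j i) (u : V → ℝ) (c : ℝ) :
    treeGen W (fun i => u i - c) hW
      = (Real.exp (-c) ^ (Fintype.card V - 1)) ^ 2 * treeGen W u hW := by
  rw [← pow_mul, mul_comm _ 2, pow_mul, treeGen, treeGen, ← treePoly_const_mul]
  congr 1
  ext e
  induction e with
  | h i j =>
    simp only [Sym2.lift_mk]
    rw [← Real.exp_nat_mul, mul_left_comm, ← Real.exp_add]
    congr 2
    push_cast
    ring

/-- Shifting `u` by a constant `c` changes the density at `x` only through the tree and vertex
factors, whose scalings cancel. -/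
lemma mixDensity_one_sub_const {V : Type*} [Fintype V] [DecidableEq V]
    (W : V → V → ℝ) (hW : ∀ i j, W i j = W j i) (x : V) (u : V → ℝ) (c : ℝ) :
    mixDensity W hW (fun _ => 1) x (fun i => u i - c) = mixDensity W hW (fun _ => 1) x u := by
  have hprod : ∏ i ∈ Finset.univ.filter (fun i => i ≠ x),
        (1 * Real.exp (-(u i - c)) / Real.sqrt (2 * Real.pi))
      = Real.exp c ^ (Fintype.card V - 1) * ∏ i ∈ Finset.univ.filter (fun i => i ≠ x),
        (1 * Real.exp (-u i) / Real.sqrt (2 * Real.pi)) := by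
    have hcard : (Finset.univ.filter (fun i => i ≠ x)).card = Fintype.card V - 1 := by
      rw [Finset.filter_ne', Finset.card_erase_of_mem (Finset.mem_univ x), Finset.card_univ]
    rw [← hcard, ← Finset.prod_const, ← Finset.prod_mul_distrib]
    refine Finset.prod_congr rfl fun i _ => ?_
    rw [neg_sub, sub_eq_add_neg, Real.exp_add]
    ring
  have hcancel : Real.exp (-c) ^ (Fintype.card V - 1) * Real.exp c ^ (Fintype.card V - 1) = 1 := by
    rw [← mul_pow, ← Real.exp_add, neg_add_cancel, Real.exp_zero, one_pow]
  simp only [mixDensity, sub_sub_sub_cancel_right]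
  rw [hprod, treeGen_sub_const, Real.sqrt_mul (sq_nonneg _), Real.sqrt_sq (by positivity),
    mul_left_comm (Real.exp _), mul_mul_mul_comm, hcancel, one_mul]

/-- Moving the excluded vertex from `a` to `b`. -/
lemma exp_mul_mixDensity_one {V : Type*} [Fintype V] [DecidableEq V]
    (W : V → V → ℝ) (hW : ∀ i j, W i j = W j i) (a b : V) (u : V → ℝ) :
    Real.exp (u b - u a) * mixDensity W hW (fun _ => 1) a u
      = mixDensity W hW (fun _ => 1) b u := by
  have hprod (x : V) : ∏ i ∈ Finset.univ.filter (fun i => i ≠ x),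
        (1 * Real.exp (-u i) / Real.sqrt (2 * Real.pi))
      = Real.exp (u x) * Real.sqrt (2 * Real.pi)
        * ∏ i, (1 * Real.exp (-u i) / Real.sqrt (2 * Real.pi)) := by
    have hpi : Real.sqrt (2 * Real.pi) ≠ 0 := by positivity
    rw [Finset.filter_ne', ← Finset.mul_prod_erase _ _ (Finset.mem_univ x), Real.exp_neg]
    field_simp
  simp only [mixDensity]
  rw [hprod a, hprod b, Real.exp_sub]
  field_simp

/-- **Shift in the mixing measure** (Statement 3, Lemma 2.1 of the paper).
For unit initial local times, `e^{u_b - u_a} ρ^{W,1}_a(u) = ρ^{W,1}_b(u')` where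
`u'_i = u_i - u_b`. -/
theorem mixDensity_shift {V : Type*} [Fintype V] [DecidableEq V]
    (W : V → V → ℝ) (hW : ∀ i j, W i j = W j i)
    (hnn : ∀ i j, 0 ≤ W i j) (hdiag : ∀ i, W i i = 0)
    (hconn : (SimpleGraph.fromRel (fun i j => 0 < W i j)).Connected)
    (a b : V) (u : V → ℝ) (hua : u a = 0) :
    Real.exp (u b - u a) * mixDensity W hW (fun _ => 1) a u
      = mixDensity W hW (fun _ => 1) b (fun i => u i - u b) := by
  rw [mixDensity_one_sub_const, exp_mul_mixDensity_one]
end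

section
/- Let V be a finite nonempty set, let W : V × V → ℝ be symmetric, nonnegative, with zero diagonal, such that the graph on V whose edges are the pairs {i,j} with W_{ij} > 0 is connected, let ϑ : V → (0,∞), and fix i₀ ∈ V. Then ∫_{ℝ^{V∖{i₀}}} exp(−(1/2) Σ_{{i,j}} W_{ij}(e^{u_i−u_j} ϑ_j² + e^{u_j−u_i} ϑ_i² − 2 ϑ_i ϑ_j)) · √(D(W,u)) · ∏_{i∈V∖{i₀}} (ϑ_i e^{−u_i}/√(2π)) ∏_{i≠i₀} du_i = 1, where u_{i₀} := 0, Σ_{{i,j}} runs over unordered pairs of distinct vertices, and D(W,u) = Σ_T ∏_{{i,j}∈E(T)} W_{ij} e^{u_i+u_j} with the sum over all spanning trees T of the complete graph on V. -/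
/-- Extend `u : V∖{a} → ℝ` to `V → ℝ` by setting the value `0` at the pinned vertex `a`. -/
def pin {V : Type*} [DecidableEq V] (a : V) (u : {i : V // i ≠ a} → ℝ) : V → ℝ :=
  fun i => if h : i = a then 0 else u ⟨i, h⟩

open MeasureTheory
open scoped ENNReal

/-- A map `g` from the non-root vertices to all vertices is *grounded* if following `g` always
leads to the root; this is witnessed by a rank that `g` strictly decreases. -/
def IsGrounded {V : Type*} {r : V} (g : {i : V // i ≠ r} → V) : Prop :=
  ∃ d : V → ℕ, ∀ i, d (g i) < d i

theorem det_one_sub_map_of_isGrounded {V : Type*} [Fintype V] [DecidableEq V] {r : V}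
    {g : {i : V // i ≠ r} → V} (hg : IsGrounded g) :
    (Matrix.of fun i j : {i : V // i ≠ r} =>
      (if i = j then (1 : ℝ) else 0) - if g i = j then 1 else 0).det = 1 := by
  obtain ⟨d, hd⟩ := hg
  have hM : (Matrix.of fun i j : {i : V // i ≠ r} =>
      (if i = j then (1 : ℝ) else 0) - if g i = j then 1 else 0).BlockTriangular
        (fun i => OrderDual.toDual (d i)) := by
    intro i j hij
    have hij : d i < d j := hij
    have h1 : i ≠ j := by rintro rfl; exact lt_irrefl _ hij
    have h2 : g i ≠ j := fun h => lt_asymm hij (h ▸ hd i)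
    simp [h1, h2]
  rw [hM.det]
  refine Finset.prod_eq_one fun a _ => ?_
  refine (congrArg Matrix.det ?_).trans Matrix.det_one
  ext i j
  have h2 : g i ≠ j.1 := fun h => by
    have h3 := hd i
    rw [h] at h3
    exact h3.ne (OrderDual.toDual.injective (j.2.trans i.2.symm))
  simp [Matrix.toSquareBlock, Matrix.toSquareBlockProp, Matrix.one_apply, h2, Subtype.ext_iff]

theorem det_one_sub_map_of_not_isGrounded {V : Type*} [Fintype V] [DecidableEq V] {r : V}
    {g : {i : V // i ≠ r} → V} (hg : ¬ IsGrounded g) :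
    (Matrix.of fun i j : {i : V // i ≠ r} =>
      (if i = j then (1 : ℝ) else 0) - if g i = j then 1 else 0).det = 0 := by
  classical
  let G : V → V := fun i => if h : i = r then r else g ⟨i, h⟩
  have hG (i : {i : V // i ≠ r}) : G i = g i := by simp [G, i.2]
  have hGr : G r = r := by simp [G]
  have hreach (i : V) : (∃ n, G^[n] (G i) = r) ↔ ∃ n, G^[n] i = r := by
    constructor
    · rintro ⟨n, hn⟩
      exact ⟨n + 1, hn⟩
    · rintro ⟨n, hn⟩
      refine ⟨n, ?_⟩
      rw [← Function.iterate_succ_apply, Function.iterate_succ_apply', hn, hGr]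
  have hex : ∃ i, ¬ ∃ n, G^[n] i = r := by
    by_contra! h
    refine hg ⟨fun i => Nat.find (h i), fun i => ?_⟩
    have hi := Nat.find_spec (h i.1)
    rcases hn : Nat.find (h i.1) with _ | n
    · rw [hn] at hi
      exact absurd hi i.2
    · rw [hn, Function.iterate_succ_apply, hG] at hi
      exact (Nat.lt_succ_of_le (Nat.find_min' (h (g i)) hi)).trans_eq hn.symm
  obtain ⟨v, hv⟩ := hex
  have hvr : v ≠ r := by rintro rfl; exact hv ⟨0, rfl⟩
  let y : V → ℝ := fun i => if ∃ n, G^[n] i = r then 0 else 1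
  have hyr : y r = 0 := if_pos ⟨0, rfl⟩
  refine Matrix.exists_mulVec_eq_zero_iff.1 ⟨fun i => y i, fun h => ?_, ?_⟩
  · simpa [y, hv] using congrFun h ⟨v, hvr⟩
  · ext i
    have h1 : ∑ j : {i : V // i ≠ r}, (if g i = j then (1 : ℝ) else 0) * y j = y (g i) := by
      have := Fintype.sum_eq_add_sum_subtype_ne (fun j => (if g i = j then (1 : ℝ) else 0) * y j) r
      simp only [hyr, mul_zero, zero_add] at this
      rw [← this]
      simp
    have h2 : y (g i) = y i := by
      simp only [y, ← hG, hreach]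
    simp only [ne_eq, Matrix.mulVec, dotProduct, Matrix.of_apply, sub_mul, Finset.sum_sub_distrib,
      Pi.zero_apply] at h1 ⊢
    rw [h1, h2]
    simp

theorem det_diagonal_sub_eq_sum_isGrounded {V : Type*} [Fintype V] [DecidableEq V] (r : V)
    (f : V → V → ℝ) [DecidablePred (IsGrounded (r := r))] :
    (Matrix.diagonal (fun i : {i : V // i ≠ r} => ∑ k, f i k) -
      Matrix.of fun i j : {i : V // i ≠ r} => f i j).det =
      ∑ g with IsGrounded (r := r) g, ∏ i : {i : V // i ≠ r}, f i (g i) := by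
  have hrow : (Matrix.diagonal (fun i : {i : V // i ≠ r} => ∑ k, f i k) -
      Matrix.of fun i j : {i : V // i ≠ r} => f i j) = fun i : {i : V // i ≠ r} => ∑ k, f i k •
        fun j : {i : V // i ≠ r} => (if i = j then (1 : ℝ) else 0) - if k = j then 1 else 0 := by
    ext i j
    simp [Matrix.diagonal_apply, mul_sub, Finset.sum_apply]
  rw [hrow]
  change Matrix.detRowAlternating.toMultilinearMap _ = _
  rw [MultilinearMap.map_sum, Finset.sum_filter]
  refine Finset.sum_congr rfl fun g _ => ?_
  rw [MultilinearMap.map_smul_univ, smul_eq_mul]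
  change _ * (Matrix.of fun i j : {i : V // i ≠ r} =>
      (if i = j then (1 : ℝ) else 0) - if g i = j then 1 else 0).det = _
  split_ifs with hg
  · rw [det_one_sub_map_of_isGrounded hg, mul_one]
  · rw [det_one_sub_map_of_not_isGrounded hg, mul_zero]

theorem mem_spanningTrees {V : Type*} [Fintype V] [DecidableEq V] {T : Finset (Sym2 V)} :
    T ∈ spanningTrees V ↔
      (SimpleGraph.fromEdgeSet (T : Set (Sym2 V))).IsTree ∧ ∀ e ∈ T, ¬ e.IsDiag := by
  simp [spanningTrees]

theorem edgeSet_fromEdgeSet_of_not_isDiag {V : Type*} {T : Set (Sym2 V)}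
    (hT : ∀ e ∈ T, ¬ e.IsDiag) : (SimpleGraph.fromEdgeSet T).edgeSet = T := by
  rw [SimpleGraph.edgeSet_fromEdgeSet]
  ext e
  simpa using hT e

theorem card_add_one_of_mem_spanningTrees {V : Type*} [Fintype V] [DecidableEq V]
    {T : Finset (Sym2 V)} (hT : T ∈ spanningTrees V) : T.card + 1 = Fintype.card V := by
  obtain ⟨h1, h2⟩ := mem_spanningTrees.1 hT
  have h := (SimpleGraph.isTree_iff_connected_and_card.1 h1).2
  rw [edgeSet_fromEdgeSet_of_not_isDiag (by simpa using h2)] at h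
  simpa using h

/-- The edges `{i, g i}` of the graph of `g`. -/
def mapEdges {V : Type*} [Fintype V] [DecidableEq V] {r : V} (g : {i : V // i ≠ r} → V) :
    Finset (Sym2 V) :=
  Finset.univ.image fun i => s(i.1, g i)

theorem IsGrounded.injective_edge {V : Type*} {r : V} {g : {i : V // i ≠ r} → V}
    (hg : IsGrounded g) : Function.Injective fun i => s(i.1, g i) := by
  obtain ⟨d, hd⟩ := hg
  intro i j hij
  rcases Sym2.eq_iff.1 hij with ⟨h, -⟩ | ⟨h1, h2⟩
  · exact Subtype.ext h
  · have h3 := hd i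
    have h4 := hd j
    rw [h2] at h3
    rw [← h1] at h4
    exact absurd h3 h4.asymm

theorem IsGrounded.mapEdges_mem_spanningTrees {V : Type*} [Fintype V] [DecidableEq V] {r : V}
    {g : {i : V // i ≠ r} → V} (hg : IsGrounded g) : mapEdges g ∈ spanningTrees V := by
  have hinj := hg.injective_edge
  obtain ⟨d, hd⟩ := hg
  have hne (i) : i.1 ≠ g i := fun h => (hd i).ne (by rw [← h])
  have hdiag : ∀ e ∈ mapEdges g, ¬ e.IsDiag := by
    intro e he
    obtain ⟨i, -, rfl⟩ := Finset.mem_image.1 he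
    simpa using hne i
  refine mem_spanningTrees.2 ⟨SimpleGraph.isTree_iff_connected_and_card.2 ⟨?_, ?_⟩, hdiag⟩
  · have hr (n : ℕ) : ∀ i, d i = n →
        (SimpleGraph.fromEdgeSet (mapEdges g : Set (Sym2 V))).Reachable i r := by
      induction n using Nat.strong_induction_on with
      | _ n ih =>
        rintro i rfl
        by_cases hi : i = r
        · rw [hi]
        · have hadj : (SimpleGraph.fromEdgeSet (mapEdges g : Set (Sym2 V))).Adj i (g ⟨i, hi⟩) :=
            (SimpleGraph.fromEdgeSet_adj _).2
              ⟨by simpa [mapEdges] using ⟨i, hi, Or.inl ⟨rfl, rfl⟩⟩, hne ⟨i, hi⟩⟩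
          exact hadj.reachable.trans (ih _ (hd ⟨i, hi⟩) _ rfl)
    have : Nonempty V := ⟨r⟩
    exact ⟨fun i j => (hr _ i rfl).trans (hr _ j rfl).symm⟩
  · rw [edgeSet_fromEdgeSet_of_not_isDiag (by simpa using hdiag)]
    have hcard : (mapEdges g).card = Fintype.card {i : V // i ≠ r} :=
      Finset.card_image_of_injective _ hinj
    have hV : 0 < Fintype.card V := Fintype.card_pos_iff.2 ⟨r⟩
    have hU : Fintype.card {i : V // i ≠ r} = Fintype.card V - 1 := by simp
    simp only [SetLike.coe_sort_coe, Nat.card_eq_fintype_card, Fintype.card_coe]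
    omega

theorem IsGrounded.eq_of_mapEdges_eq {V : Type*} [Fintype V] [DecidableEq V] {r : V}
    {g h : {i : V // i ≠ r} → V} (hg : IsGrounded g) (hgh : mapEdges g = mapEdges h) : g = h := by
  obtain ⟨d, hd⟩ := hg
  have key (n : ℕ) : ∀ i : {i : V // i ≠ r}, d i = n → g i = h i := by
    induction n using Nat.strong_induction_on with
    | _ n ih =>
      rintro i rfl
      have hmem : s(i.1, g i) ∈ mapEdges h := hgh ▸ Finset.mem_image_of_mem _ (Finset.mem_univ i)
      obtain ⟨j, -, hj⟩ := Finset.mem_image.1 hmem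
      rcases Sym2.eq_iff.1 hj with ⟨h1, h2⟩ | ⟨h1, h2⟩
      · rw [← h2, Subtype.ext h1]
      · have h3 := hd i
        have h4 := hd j
        rw [← h1] at h3
        rw [ih _ h3 j rfl, h2] at h4
        exact absurd h3 h4.asymm
  exact funext fun i => key _ i rfl

theorem exists_isGrounded_of_mem_spanningTrees {V : Type*} [Fintype V] [DecidableEq V] (r : V)
    {T : Finset (Sym2 V)} (hT : T ∈ spanningTrees V) :
    ∃ g : {i : V // i ≠ r} → V, IsGrounded g ∧ mapEdges g = T := by
  have htree := (mem_spanningTrees.1 hT).1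
  have hstep (i : {i : V // i ≠ r}) : ∃ k, s(i.1, k) ∈ T ∧
      (SimpleGraph.fromEdgeSet (T : Set (Sym2 V))).dist k r <
        (SimpleGraph.fromEdgeSet (T : Set (Sym2 V))).dist i r := by
    obtain ⟨i, hi⟩ := i
    obtain ⟨p, hp⟩ := htree.connected.exists_walk_length_eq_dist i r
    cases p with
    | nil => exact absurd rfl hi
    | cons hadj q =>
      refine ⟨_, ((SimpleGraph.fromEdgeSet_adj _).1 hadj).1, ?_⟩
      rw [← hp, SimpleGraph.Walk.length_cons]
      exact Nat.lt_succ_of_le (SimpleGraph.dist_le q)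
  choose g hgT hgd using hstep
  have hg : IsGrounded g :=
    ⟨fun k => (SimpleGraph.fromEdgeSet (T : Set (Sym2 V))).dist k r, hgd⟩
  refine ⟨g, hg, Finset.eq_of_subset_of_card_le ?_ ?_⟩
  · intro e he
    obtain ⟨i, -, rfl⟩ := Finset.mem_image.1 he
    exact hgT i
  · have h1 := card_add_one_of_mem_spanningTrees hT
    have h2 := card_add_one_of_mem_spanningTrees hg.mapEdges_mem_spanningTrees
    omega

/-- The **weighted matrix-tree theorem**: the determinant of the Laplacian with the row and the
column of the root `r` removed is the spanning-tree polynomial. -/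
theorem det_diagonal_sub_eq_treePoly {V : Type*} [Fintype V] [DecidableEq V] (r : V)
    (f : V → V → ℝ) (hf : ∀ i j, f i j = f j i) :
    (Matrix.diagonal (fun i : {i : V // i ≠ r} => ∑ k, f i k) -
      Matrix.of fun i j : {i : V // i ≠ r} => f i j).det = treePoly (Sym2.lift ⟨f, hf⟩) := by
  classical
  rw [det_diagonal_sub_eq_sum_isGrounded, treePoly]
  refine Finset.sum_bij (fun g _ => mapEdges g) ?_ ?_ ?_ ?_
  · exact fun g hg => (Finset.mem_filter.1 hg).2.mapEdges_mem_spanningTrees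
  · exact fun g hg h _ hgh => (Finset.mem_filter.1 hg).2.eq_of_mapEdges_eq hgh
  · intro T hT
    obtain ⟨g, hg, rfl⟩ := exists_isGrounded_of_mem_spanningTrees r hT
    exact ⟨g, by simpa using hg, rfl⟩
  · intro g hg
    rw [mapEdges, Finset.prod_image (Finset.mem_filter.1 hg).2.injective_edge.injOn]
    simp

/-- The even part of the Jacobian of `y ↦ (y + √(y² + a))` carries the whole Gaussian mass. -/
theorem lintegral_gaussian_mul_one_add_div_sqrt {a : ℝ} (ha : 0 < a) :
    ∫⁻ y : ℝ, ENNReal.ofReal ((1 + y / √(y ^ 2 + a)) * Real.exp (-(1 / 2) * y ^ 2)) =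
      ENNReal.ofReal √(2 * Real.pi) := by
  have hcont : Continuous fun y : ℝ => y / √(y ^ 2 + a) := by
    refine continuous_id.div (by fun_prop) fun y => ?_
    positivity
  have hle (y : ℝ) : |y / √(y ^ 2 + a)| ≤ 1 := by
    rw [abs_div, abs_of_nonneg (Real.sqrt_nonneg _)]
    refine div_le_one_of_le₀ (Real.abs_le_sqrt (by linarith)) (Real.sqrt_nonneg _)
  have hg : Integrable fun y : ℝ => Real.exp (-(1 / 2) * y ^ 2) :=
    integrable_exp_neg_mul_sq (by norm_num)
  have hodd : Integrable fun y : ℝ => y / √(y ^ 2 + a) * Real.exp (-(1 / 2) * y ^ 2) :=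
    hg.bdd_mul (c := 1) hcont.aestronglyMeasurable (.of_forall hle)
  have hzero : ∫ y : ℝ, y / √(y ^ 2 + a) * Real.exp (-(1 / 2) * y ^ 2) = 0 := by
    have h := integral_neg_eq_self
      (fun y : ℝ => y / √(y ^ 2 + a) * Real.exp (-(1 / 2) * y ^ 2)) volume
    simp only [neg_sq, neg_div, neg_mul, integral_neg] at h
    simp only [neg_mul]
    linarith
  rw [← ofReal_integral_eq_lintegral_ofReal]
  · congr 1
    simp only [add_mul, one_mul]
    rw [integral_add hg hodd, hzero, integral_gaussian, add_zero]
    congr 1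
    ring
  · simp only [add_mul, one_mul]
    exact hg.add hodd
  · refine .of_forall fun y => mul_nonneg ?_ (Real.exp_pos _).le
    linarith [(abs_le.1 (hle y)).1]

theorem lintegral_inverseGaussian {t c : ℝ} (ht : 0 < t) (hc : 0 ≤ c) :
    ∫⁻ s in Set.Ioi (0 : ℝ), ENNReal.ofReal
      (Real.exp (-(1 / 2) * (t ^ 2 * s + c ^ 2 / s - 2 * (t * c))) / √s) =
      ENNReal.ofReal (√(2 * Real.pi) / t) := by
  rcases hc.eq_or_lt with rfl | hc
  · have key := Real.integral_rpow_mul_exp_neg_mul_Ioi (a := 1 / 2) (r := t ^ 2 / 2)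
      (by norm_num) (by positivity)
    have hval : (1 / (t ^ 2 / 2)) ^ (1 / 2 : ℝ) * Real.Gamma (1 / 2) = √(2 * Real.pi) / t := by
      rw [Real.Gamma_one_half_eq, ← Real.sqrt_eq_rpow, one_div_div, Real.sqrt_div (by norm_num),
        Real.sqrt_sq ht.le, Real.sqrt_mul (by norm_num)]
      ring
    rw [hval] at key
    have hintegrable : IntegrableOn
        (fun s : ℝ => s ^ (1 / 2 - 1 : ℝ) * Real.exp (-(t ^ 2 / 2 * s))) (Set.Ioi 0) :=
      .of_integral_ne_zero (by rw [key]; positivity)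
    rw [← key, ofReal_integral_eq_lintegral_ofReal hintegrable]
    · refine setLIntegral_congr_fun measurableSet_Ioi fun s hs => ?_
      have hs : 0 < s := hs
      congr 1
      rw [show (1 / 2 - 1 : ℝ) = -(1 / 2) by norm_num, Real.rpow_neg hs.le, ← Real.sqrt_eq_rpow,
        div_eq_inv_mul]
      congr 2
      ring
    · exact ae_restrict_of_forall_mem measurableSet_Ioi fun s hs =>
        mul_nonneg (Real.rpow_nonneg (le_of_lt hs) _) (Real.exp_pos _).le
  · set a := 4 * t * c with ha
    have hapos : 0 < a := by positivity
    let x : ℝ → ℝ := fun y => (y + √(y ^ 2 + a)) / (2 * t)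
    have hr (y : ℝ) : 0 < √(y ^ 2 + a) := by positivity
    have hrsq (y : ℝ) : √(y ^ 2 + a) ^ 2 = y ^ 2 + a := Real.sq_sqrt (by positivity)
    have hlt (y : ℝ) : -y < √(y ^ 2 + a) := Real.lt_sqrt_of_sq_lt (by nlinarith)
    have hx (y : ℝ) : 0 < x y := div_pos (by linarith [hlt y]) (by positivity)
    have hxy (y : ℝ) : t * x y - c / x y = y := by
      have h1 : y + √(y ^ 2 + a) ≠ 0 := by linarith [hlt y]
      simp only [x]
      field_simp
      linear_combination hrsq y
    have hxr (y : ℝ) : 2 * t * x y = y + √(y ^ 2 + a) := by simp only [x]; field_simp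
    have hderiv (y : ℝ) : HasDerivAt (fun y => x y ^ 2) (2 * x y ^ 2 / √(y ^ 2 + a)) y := by
      have h1 : HasDerivAt (fun y : ℝ => y ^ 2 + a) (2 * y) y := by
        simpa using (hasDerivAt_pow 2 y).add_const a
      have h2 := (((hasDerivAt_id y).add (h1.sqrt (by positivity))).div_const (2 * t)).pow 2
      refine h2.congr_deriv ?_
      have := (hr y).ne'
      simp only [x, id, Pi.add_apply, Nat.add_one_sub_one, pow_one, Nat.cast_ofNat]
      field_simp
      ring
    have hinj : Set.InjOn (fun y => x y ^ 2) Set.univ := fun y _ z _ h => by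
      have h : x y = x z := (sq_eq_sq₀ (hx y).le (hx z).le).1 h
      rw [← hxy y, ← hxy z, h]
    have himage : (fun y => x y ^ 2) '' Set.univ = Set.Ioi 0 := by
      ext s
      constructor
      · rintro ⟨y, -, rfl⟩
        exact pow_pos (hx y) 2
      · intro hs
        have hs : 0 < s := hs
        have hq : 0 < √s := Real.sqrt_pos.2 hs
        refine ⟨t * √s - c / √s, trivial, ?_⟩
        have h1 : (t * √s - c / √s) ^ 2 + a = (t * √s + c / √s) ^ 2 := by
          rw [ha]; field_simp; ring
        simp only [x]
        rw [h1, Real.sqrt_sq (by positivity)]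
        field_simp
        rw [show t * √s ^ 2 - c + (t * √s ^ 2 + c) = 2 * t * √s ^ 2 by ring]
        field_simp
        rw [Real.sq_sqrt hs.le]
    rw [← himage, lintegral_image_eq_lintegral_abs_deriv_mul MeasurableSet.univ
      (fun y _ => (hderiv y).hasDerivWithinAt) hinj, setLIntegral_univ,
      div_eq_inv_mul (√(2 * Real.pi)), ENNReal.ofReal_mul (by positivity),
      ← lintegral_gaussian_mul_one_add_div_sqrt hapos, ← lintegral_const_mul' _ _ (by simp)]
    refine lintegral_congr fun y => ?_
    have hxp := hx y
    have hrp := hr y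
    rw [abs_of_nonneg (by positivity), ← ENNReal.ofReal_mul (by positivity),
      ← ENNReal.ofReal_mul (by positivity), Real.sqrt_sq hxp.le]
    congr 1
    have he : t ^ 2 * x y ^ 2 + c ^ 2 / x y ^ 2 - 2 * (t * c) = y ^ 2 := by
      refine Eq.trans ?_ (congrArg (· ^ 2) (hxy y))
      field_simp
      ring
    rw [he, show 1 + y / √(y ^ 2 + a) = 2 * t * x y / √(y ^ 2 + a) by
      rw [hxr]; field_simp; ring]
    field_simp

/-- An M-matrix is inverse-positive. -/
theorem Matrix.PosDef.nonneg_of_mulVec_nonneg {α : Type*} [Fintype α] {A : Matrix α α ℝ}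
    (hA : A.PosDef) (hoff : ∀ i j, i ≠ j → A i j ≤ 0) {x : α → ℝ}
    (hx : ∀ i, 0 ≤ (A.mulVec x) i) (i : α) : 0 ≤ x i := by
  by_contra! hi
  let n : α → ℝ := fun i => max (-x i) 0
  have hn0 : n ≠ 0 := fun h => by
    have := congrFun h i
    simp only [n, Pi.zero_apply] at this
    linarith [le_max_left (-x i) 0]
  have hpos : 0 < n ⬝ᵥ A.mulVec n := by simpa using hA.dotProduct_mulVec_pos hn0
  have h1 : 0 ≤ n ⬝ᵥ A.mulVec x :=
    Finset.sum_nonneg fun i _ => mul_nonneg (le_max_right _ _) (hx i)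
  have h2 : n ⬝ᵥ A.mulVec (x + n) ≤ 0 := by
    refine Finset.sum_nonpos fun i _ => ?_
    rw [Matrix.mulVec, dotProduct, Finset.mul_sum]
    refine Finset.sum_nonpos fun j _ => ?_
    have hni : 0 ≤ n i := le_max_right _ _
    have hpj : 0 ≤ (x + n) j := by
      simp only [n, Pi.add_apply]
      linarith [le_max_left (-x j) 0]
    by_cases hij : i = j
    · subst hij
      simp only [n, Pi.add_apply]
      rcases le_total (-x i) 0 with h | h
      · simp [max_eq_right h]
      · simp [max_eq_left h]
    · exact mul_nonpos_of_nonneg_of_nonpos hni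
        (mul_nonpos_of_nonpos_of_nonneg (hoff i j hij) hpj)
  rw [Matrix.mulVec_add, dotProduct_add] at h2
  linarith

/-- The symmetric matrix `A` bordered by the vector `-w` and the corner entry `D`. -/
def borderedMatrix {α : Type*} (A : Matrix α α ℝ) (w : α → ℝ) (D : ℝ) :
    Matrix (α ⊕ Unit) (α ⊕ Unit) ℝ :=
  Matrix.fromBlocks A (Matrix.of fun i _ => -w i) (Matrix.of fun _ i => -w i)
    (Matrix.of fun _ _ => D)

theorem borderedMatrix_mulVec {α : Type*} [Fintype α] (A : Matrix α α ℝ) (w : α → ℝ) (D : ℝ)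
    (x : α → ℝ) (z : ℝ) :
    (borderedMatrix A w D).mulVec (Sum.elim x fun _ => z) =
      Sum.elim (A.mulVec x - z • w) fun _ => D * z - w ⬝ᵥ x := by
  ext (i | i)
  · simp [borderedMatrix, Matrix.mulVec, dotProduct, sub_eq_add_neg, mul_comm]
  · simp [borderedMatrix, Matrix.mulVec, dotProduct, sub_eq_add_neg, add_comm]

theorem det_borderedMatrix {α : Type*} [Fintype α] [DecidableEq α] {A : Matrix α α ℝ}
    (hA : A.PosDef) (w : α → ℝ) (D : ℝ) :
    (borderedMatrix A w D).det = A.det * (D - w ⬝ᵥ A⁻¹.mulVec w) := by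
  have := hA.isUnit.invertible
  rw [borderedMatrix, Matrix.det_fromBlocks₁₁, Matrix.invOf_eq_nonsing_inv]
  congr 1
  simp [Matrix.det_unique, Matrix.mul_apply, Matrix.mulVec, dotProduct, Finset.sum_mul,
    Finset.mul_sum, mul_assoc]
  exact Finset.sum_comm

theorem mulVec_inv_mulVec {α : Type*} [Fintype α] [DecidableEq α] {A : Matrix α α ℝ}
    (hA : A.PosDef) (x : α → ℝ) : A.mulVec (A⁻¹.mulVec x) = x := by
  rw [Matrix.mulVec_mulVec,
    Matrix.mul_nonsing_inv _ ((Matrix.isUnit_iff_isUnit_det _).1 hA.isUnit), Matrix.one_mulVec]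

theorem dotProduct_borderedMatrix_mulVec {α : Type*} [Fintype α] [DecidableEq α]
    {A : Matrix α α ℝ} (hA : A.PosDef) (w : α → ℝ) (D : ℝ) (x : α → ℝ) (z : ℝ) :
    (Sum.elim x fun _ => z) ⬝ᵥ (borderedMatrix A w D).mulVec (Sum.elim x fun _ => z) =
      (x - z • A⁻¹.mulVec w) ⬝ᵥ A.mulVec (x - z • A⁻¹.mulVec w) +
        (D - w ⬝ᵥ A⁻¹.mulVec w) * z ^ 2 := by
  have hAi := mulVec_inv_mulVec hA w
  have hsymm : A⁻¹.mulVec w ⬝ᵥ A.mulVec x = w ⬝ᵥ x := by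
    rw [Matrix.dotProduct_mulVec, ← Matrix.mulVec_transpose,
      ← Matrix.conjTranspose_eq_transpose_of_trivial, hA.isHermitian.eq, hAi]
  rw [borderedMatrix_mulVec]
  simp only [Matrix.mulVec_sub, Matrix.mulVec_smul, hAi, dotProduct_sub, sub_dotProduct,
    smul_dotProduct, dotProduct_smul, hsymm, smul_eq_mul, sumElim_dotProduct_sumElim,
    dotProduct_comm (A⁻¹.mulVec w) w, dotProduct_comm x w]
  simp only [dotProduct, Finset.univ_unique, Finset.sum_singleton]
  ring

theorem posDef_borderedMatrix_iff {α : Type*} [Fintype α] [DecidableEq α]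
    {A : Matrix α α ℝ} {w : α → ℝ} {D : ℝ} :
    (borderedMatrix A w D).PosDef ↔ A.PosDef ∧ w ⬝ᵥ A⁻¹.mulVec w < D := by
  constructor
  · intro h
    have hA : A.PosDef := by
      refine .of_dotProduct_mulVec_pos ?_ fun x hx => ?_
      · ext i j
        simpa [borderedMatrix] using congrFun (congrFun h.isHermitian (Sum.inl i)) (Sum.inl j)
      · have := h.dotProduct_mulVec_pos (x := Sum.elim x fun _ => 0)
          fun h0 => hx (funext fun i => congrFun h0 (Sum.inl i))
        rw [borderedMatrix_mulVec] at this
        simpa [sumElim_dotProduct_sumElim] using this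
    refine ⟨hA, ?_⟩
    have := h.dotProduct_mulVec_pos (x := Sum.elim (A⁻¹.mulVec w) fun _ => 1)
      fun h0 => one_ne_zero (congrFun h0 (Sum.inr ()))
    rw [star_trivial, dotProduct_borderedMatrix_mulVec hA] at this
    simpa using this
  · rintro ⟨hA, hD⟩
    refine .of_dotProduct_mulVec_pos ?_ fun x hx => ?_
    · exact Matrix.isHermitian_fromBlocks_iff.2
        ⟨hA.isHermitian, by ext; simp, by ext; simp, by ext; simp⟩
    · obtain ⟨y, z, rfl⟩ : ∃ y z, x = Sum.elim y fun _ => z :=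
        ⟨fun i => x (Sum.inl i), x (Sum.inr ()), by ext (i | i) <;> rfl⟩
      rw [star_trivial, dotProduct_borderedMatrix_mulVec hA]
      have hs := sub_pos.2 hD
      by_cases hz : z = 0
      · subst hz
        have hy : y ≠ 0 := by
          rintro rfl
          exact hx (by ext (i | i) <;> rfl)
        simpa using hA.dotProduct_mulVec_pos hy
      · refine add_pos_of_nonneg_of_pos ?_ (by positivity)
        simpa using hA.posSemidef.dotProduct_mulVec_nonneg (y - z • A⁻¹.mulVec w)

theorem inv_mulVec_eq_of_mulVec_eq {α : Type*} [Fintype α] [DecidableEq α] {A : Matrix α α ℝ}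
    (hA : A.PosDef) {x y : α → ℝ} (h : A.mulVec x = y) : A⁻¹.mulVec y = x := by
  rw [← h, Matrix.mulVec_mulVec,
    Matrix.nonsing_inv_mul _ ((Matrix.isUnit_iff_isUnit_det _).1 hA.isUnit), Matrix.one_mulVec]

theorem dotProduct_inv_mulVec_comm {α : Type*} [Fintype α] [DecidableEq α] {A : Matrix α α ℝ}
    (hA : A.PosDef) (x y : α → ℝ) : x ⬝ᵥ A⁻¹.mulVec y = y ⬝ᵥ A⁻¹.mulVec x := by
  rw [Matrix.dotProduct_mulVec, ← Matrix.mulVec_transpose,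
    ← Matrix.conjTranspose_eq_transpose_of_trivial, hA.inv.isHermitian.eq, dotProduct_comm]

theorem dotProduct_inv_borderedMatrix_mulVec {α : Type*} [Fintype α] [DecidableEq α]
    {A : Matrix α α ℝ} {w : α → ℝ} {D : ℝ} (hA : A.PosDef) (hD : w ⬝ᵥ A⁻¹.mulVec w < D)
    (η : α → ℝ) (e : ℝ) :
    (Sum.elim η fun _ => e) ⬝ᵥ (borderedMatrix A w D)⁻¹.mulVec (Sum.elim η fun _ => e) =
      η ⬝ᵥ A⁻¹.mulVec η + (e + w ⬝ᵥ A⁻¹.mulVec η) ^ 2 / (D - w ⬝ᵥ A⁻¹.mulVec w) := by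
  have hs := (sub_pos.2 hD).ne'
  have hsolve : (borderedMatrix A w D).mulVec
      (Sum.elim (A⁻¹.mulVec (η + ((e + w ⬝ᵥ A⁻¹.mulVec η) / (D - w ⬝ᵥ A⁻¹.mulVec w)) • w))
        fun _ => (e + w ⬝ᵥ A⁻¹.mulVec η) / (D - w ⬝ᵥ A⁻¹.mulVec w)) =
      Sum.elim η fun _ => e := by
    rw [borderedMatrix_mulVec, mulVec_inv_mulVec hA, add_sub_cancel_right]
    congr 1
    ext
    rw [Matrix.mulVec_add, Matrix.mulVec_smul, dotProduct_add, dotProduct_smul, smul_eq_mul]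
    field_simp
    ring
  rw [inv_mulVec_eq_of_mulVec_eq (posDef_borderedMatrix_iff.2 ⟨hA, hD⟩) hsolve,
    sumElim_dotProduct_sumElim, Matrix.mulVec_add, Matrix.mulVec_smul, dotProduct_add,
    dotProduct_smul, smul_eq_mul, dotProduct_inv_mulVec_comm hA η w]
  simp only [dotProduct, Finset.univ_unique, Finset.sum_singleton]
  ring

/-- The exponent `⟨θ, Hθ⟩ + ⟨η, H⁻¹η⟩ - 2⟨θ, η⟩` of the random Schrödinger potential. -/
noncomputable def potentialEnergy {α : Type*} [Fintype α] [DecidableEq α] (H : Matrix α α ℝ)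
    (η θ : α → ℝ) : ℝ :=
  θ ⬝ᵥ H.mulVec θ + η ⬝ᵥ H⁻¹.mulVec η - 2 * (θ ⬝ᵥ η)

/-- The unnormalized density, in terms of the operator `H`, of the random Schrödinger potential. -/
noncomputable def potentialDensity {α : Type*} [Fintype α] [DecidableEq α] (H : Matrix α α ℝ)
    (η θ : α → ℝ) : ℝ :=
  Real.exp (-(1 / 2) * potentialEnergy H η θ) / √H.det

theorem potentialDensity_submatrix {α β : Type*} [Fintype α] [DecidableEq α] [Fintype β]
    [DecidableEq β] (e : α ≃ β) (H : Matrix β β ℝ) (η θ : β → ℝ) :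
    potentialDensity (H.submatrix e e) (η ∘ e) (θ ∘ e) = potentialDensity H η θ := by
  simp only [potentialDensity, potentialEnergy, Matrix.det_submatrix_equiv_self,
    Matrix.inv_submatrix_equiv, Matrix.submatrix_mulVec_equiv, comp_equiv_dotProduct_comp_equiv,
    Function.comp_assoc, Equiv.self_comp_symm, Function.comp_id]

theorem posDef_submatrix_equiv {α β : Type*} [Finite α] [Finite β] (e : α ≃ β)
    {H : Matrix β β ℝ} : (H.submatrix e e).PosDef ↔ H.PosDef :=
  ⟨fun h => by simpa using h.submatrix e.symm.injective, fun h => h.submatrix e.injective⟩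

theorem continuous_diagonal_sub {α : Type*} [DecidableEq α] (W : Matrix α α ℝ) :
    Continuous fun b : α → ℝ => Matrix.diagonal b - W :=
  continuous_id.matrix_diagonal.sub continuous_const

theorem measurableSet_posDef_diagonal_sub {α : Type*} [Fintype α] [DecidableEq α]
    (W : Matrix α α ℝ) (hW : W.IsSymm) :
    MeasurableSet {b : α → ℝ | (Matrix.diagonal b - W).PosDef} := by
  have hH (b : α → ℝ) : (Matrix.diagonal b - W).IsHermitian := by
    rw [Matrix.IsHermitian, Matrix.conjTranspose_eq_transpose_of_trivial, Matrix.transpose_sub,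
      Matrix.diagonal_transpose, hW.eq]
  have heq : {b : α → ℝ | (Matrix.diagonal b - W).PosDef} =
      (⋂ x : α → ℝ, {b | 0 ≤ x ⬝ᵥ (Matrix.diagonal b - W).mulVec x}) ∩
        {b | (Matrix.diagonal b - W).det ≠ 0} := by
    ext b
    simp only [Set.mem_ofPred_eq, Set.mem_inter_iff, Set.mem_iInter]
    constructor
    · exact fun h =>
        ⟨fun x => by simpa using h.posSemidef.dotProduct_mulVec_nonneg x, h.det_pos.ne'⟩
    · rintro ⟨h1, h2⟩
      exact (Matrix.PosSemidef.of_dotProduct_mulVec_nonneg (hH b)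
        (by simpa using h1)).posDef_iff_det_ne_zero.2 h2
  rw [heq]
  have hc := continuous_diagonal_sub W
  refine (IsClosed.measurableSet (isClosed_iInter fun x => ?_)).inter
    (IsOpen.measurableSet ?_)
  · exact isClosed_le continuous_const
      (continuous_const.dotProduct (hc.matrix_mulVec continuous_const))
  · exact isOpen_ne_fun hc.matrix_det continuous_const

theorem measurable_potentialDensity_diagonal_sub {α : Type*} [Fintype α] [DecidableEq α]
    (W : Matrix α α ℝ) (η θ : α → ℝ) :
    Measurable fun b : α → ℝ => potentialDensity (Matrix.diagonal b - W) η θ := by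
  have hc := continuous_diagonal_sub W
  have hinv (b : α → ℝ) : η ⬝ᵥ (Matrix.diagonal b - W)⁻¹.mulVec η =
      (Matrix.diagonal b - W).det⁻¹ * (η ⬝ᵥ (Matrix.diagonal b - W).adjugate.mulVec η) := by
    rw [Matrix.inv_def, Ring.inverse_eq_inv', Matrix.smul_mulVec, dotProduct_smul, smul_eq_mul]
  simp only [potentialDensity, potentialEnergy, hinv]
  have hdet := hc.matrix_det.measurable
  have hadj : Measurable fun b : α → ℝ => η ⬝ᵥ (Matrix.diagonal b - W).adjugate.mulVec η :=
    (continuous_const.dotProduct (hc.matrix_adjugate.matrix_mulVec continuous_const)).measurable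
  have hquad : Measurable fun b : α → ℝ => θ ⬝ᵥ (Matrix.diagonal b - W).mulVec θ :=
    (continuous_const.dotProduct (hc.matrix_mulVec continuous_const)).measurable
  fun_prop

/-- The density of the random Schrödinger potential has total mass `∏ √(2π) / θᵢ`, for all
symmetric nonnegative weights on `α`. -/
def PotentialMassFormula (α : Type*) [Fintype α] [DecidableEq α] : Prop :=
  ∀ (W : Matrix α α ℝ) (η θ : α → ℝ), W.IsSymm → (∀ i j, 0 ≤ W i j) → (∀ i, 0 ≤ η i) →
    (∀ i, 0 < θ i) →
    ∫⁻ b in {b : α → ℝ | (Matrix.diagonal b - W).PosDef},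
      ENNReal.ofReal (potentialDensity (Matrix.diagonal b - W) η θ) =
      ∏ i, ENNReal.ofReal (√(2 * Real.pi) / θ i)

theorem PotentialMassFormula.of_equiv {α β : Type*} [Fintype α] [DecidableEq α] [Fintype β]
    [DecidableEq β] (e : α ≃ β) (h : PotentialMassFormula α) : PotentialMassFormula β := by
  intro W η θ hW hW0 hη hθ
  have key := h (W.submatrix e e) (η ∘ e) (θ ∘ e) (hW.submatrix e) (fun i j => hW0 _ _)
    (fun i => hη _) (fun i => hθ _)
  have hmp := (volume_measurePreserving_piCongrLeft (fun _ : β => ℝ) e).symm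
  have hsub (b : β → ℝ) :
      Matrix.diagonal ((MeasurableEquiv.piCongrLeft (fun _ : β => ℝ) e).symm b) - W.submatrix e e =
      (Matrix.diagonal b - W).submatrix e e := by
    ext i j
    simp [Matrix.diagonal_apply, MeasurableEquiv.piCongrLeft, Equiv.piCongrLeft]
  rw [← hmp.setLIntegral_comp_preimage_emb (MeasurableEquiv.measurableEmbedding _)] at key
  simp only [Set.preimage_ofPred_eq, hsub, posDef_submatrix_equiv, potentialDensity_submatrix,
    Function.comp_apply] at key
  rw [key]
  exact e.prod_comp fun i => ENNReal.ofReal (√(2 * Real.pi) / θ i)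

theorem potentialMassFormula_of_isEmpty {α : Type*} [Fintype α] [DecidableEq α] [IsEmpty α] :
    PotentialMassFormula α := by
  intro W η θ _ _ _ _
  have huniv : {b : α → ℝ | (Matrix.diagonal b - W).PosDef} = Set.univ := by
    ext b
    simp only [Set.mem_ofPred_eq, Set.mem_univ, iff_true]
    exact .of_dotProduct_mulVec_pos (Subsingleton.elim _ _)
      fun x hx => absurd (Subsingleton.elim x 0) hx
  rw [huniv, setLIntegral_univ]
  simp [potentialDensity, potentialEnergy, volume_pi]

/-- Completing the square: the contribution of the last vertex factors into a density for its
Schur complement `s` and an energy on the remaining vertices with boundary term `η + t w`. -/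
theorem potentialDensity_borderedMatrix {α : Type*} [Fintype α] [DecidableEq α]
    {A : Matrix α α ℝ} {w : α → ℝ} {s : ℝ} (hA : A.PosDef) (hs : 0 < s) (η θ : α → ℝ) (e t : ℝ) :
    potentialDensity (borderedMatrix A w (s + w ⬝ᵥ A⁻¹.mulVec w)) (Sum.elim η fun _ => e)
        (Sum.elim θ fun _ => t) =
      potentialDensity A (η + t • w) θ *
        (Real.exp (-(1 / 2) * (t ^ 2 * s + (e + w ⬝ᵥ A⁻¹.mulVec η) ^ 2 / s -
          2 * (t * (e + w ⬝ᵥ A⁻¹.mulVec η)))) / √s) := by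
  have hen : potentialEnergy (borderedMatrix A w (s + w ⬝ᵥ A⁻¹.mulVec w))
      (Sum.elim η fun _ => e) (Sum.elim θ fun _ => t) = potentialEnergy A (η + t • w) θ +
        (t ^ 2 * s + (e + w ⬝ᵥ A⁻¹.mulVec η) ^ 2 / s - 2 * (t * (e + w ⬝ᵥ A⁻¹.mulVec η))) := by
    rw [potentialEnergy, dotProduct_inv_borderedMatrix_mulVec hA (by linarith),
      borderedMatrix_mulVec, potentialEnergy]
    simp only [sumElim_dotProduct_sumElim, dotProduct_sub, dotProduct_add, add_dotProduct,
      dotProduct_smul, smul_dotProduct, smul_eq_mul, Matrix.mulVec_add, Matrix.mulVec_smul,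
      dotProduct_inv_mulVec_comm hA η w, add_sub_cancel_right, dotProduct_comm θ w]
    simp only [dotProduct, Finset.univ_unique, Finset.sum_singleton]
    ring
  rw [potentialDensity, hen, det_borderedMatrix hA, add_sub_cancel_right, potentialDensity,
    mul_add, Real.exp_add, Real.sqrt_mul hA.det_pos.le, mul_div_mul_comm]

theorem PotentialMassFormula.sum_unit {α : Type*} [Fintype α] [DecidableEq α]
    (h : PotentialMassFormula α) : PotentialMassFormula (α ⊕ Unit) := by
  intro W η θ hW hW0 hη hθ
  let w : α → ℝ := fun i => W (Sum.inl i) (Sum.inr ())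
  let W' : Matrix α α ℝ := W.toBlocks₁₁
  let c : ℝ := W (Sum.inr ()) (Sum.inr ())
  let η' : α → ℝ := η ∘ Sum.inl
  let θ' : α → ℝ := θ ∘ Sum.inl
  let t : ℝ := θ (Sum.inr ())
  let e : ℝ := η (Sum.inr ())
  have ht : 0 < t := hθ _
  have hη' : η = Sum.elim η' fun _ => e := by ext (i | i) <;> rfl
  have hθ' : θ = Sum.elim θ' fun _ => t := by ext (i | i) <;> rfl
  let φ : (α → ℝ) × ℝ → (α ⊕ Unit → ℝ) := fun p => Sum.elim p.1 fun _ => p.2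
  have hφ : MeasurePreserving φ volume volume :=
    (volume_measurePreserving_sumPiEquivProdPi_symm (fun _ : α ⊕ Unit => ℝ)).comp
      ((MeasurePreserving.id volume).prod (volume_preserving_funUnique Unit ℝ).symm)
  have hmat (p : (α → ℝ) × ℝ) : Matrix.diagonal (φ p) - W =
      borderedMatrix (Matrix.diagonal p.1 - W') w (p.2 - c) := by
    ext (i | i) (j | j)
    · simp [φ, borderedMatrix, W', Matrix.toBlocks₁₁, Matrix.diagonal_apply]
    · simp [φ, borderedMatrix, w]
    · simpa [φ, borderedMatrix, w, Matrix.diagonal_apply] using hW.apply _ _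
    · simp [φ, borderedMatrix, c]
  have hW' : W'.IsSymm := Matrix.IsSymm.ext fun i j => hW.apply _ _
  have hmeas := ((measurable_potentialDensity_diagonal_sub W η θ).ennreal_ofReal.indicator
    (measurableSet_posDef_diagonal_sub W hW))
  rw [← lintegral_indicator (measurableSet_posDef_diagonal_sub W hW), ← hφ.lintegral_comp hmeas,
    Measure.volume_eq_prod]
  refine (lintegral_prod _ (hmeas.comp hφ.measurable).aemeasurable).trans ?_
  have hinner (b : α → ℝ) :
      ∫⁻ x : ℝ, ({b : α ⊕ Unit → ℝ | (Matrix.diagonal b - W).PosDef}.indicator fun b =>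
        ENNReal.ofReal (potentialDensity (Matrix.diagonal b - W) η θ)) (φ (b, x)) =
      {b : α → ℝ | (Matrix.diagonal b - W').PosDef}.indicator (fun b =>
        ENNReal.ofReal (potentialDensity (Matrix.diagonal b - W') (η' + t • w) θ') *
          ENNReal.ofReal (√(2 * Real.pi) / t)) b := by
    by_cases hA : (Matrix.diagonal b - W').PosDef
    · set A := Matrix.diagonal b - W' with hAdef
      have hoff (i j) (hij : i ≠ j) : A i j ≤ 0 := by
        simpa [A, W', Matrix.toBlocks₁₁, Matrix.diagonal_apply_ne _ hij] using hW0 _ _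
      have hinv : 0 ≤ e + w ⬝ᵥ A⁻¹.mulVec η' := by
        refine add_nonneg (hη _) (Finset.sum_nonneg fun i _ => mul_nonneg (hW0 _ _) ?_)
        refine hA.nonneg_of_mulVec_nonneg hoff (fun j => ?_) i
        rw [mulVec_inv_mulVec hA]
        exact hη _
      rw [Set.indicator_of_mem (by exact hA), ← lintegral_inverseGaussian ht hinv,
        ← lintegral_const_mul' _ _ ENNReal.ofReal_ne_top, ← lintegral_indicator measurableSet_Ioi,
        ← lintegral_add_right_eq_self _ (c + w ⬝ᵥ A⁻¹.mulVec w)]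
      refine lintegral_congr fun x => ?_
      have hiff : φ (b, x + (c + w ⬝ᵥ A⁻¹.mulVec w)) ∈
          {b : α ⊕ Unit → ℝ | (Matrix.diagonal b - W).PosDef} ↔ x ∈ Set.Ioi (0 : ℝ) := by
        rw [Set.mem_ofPred_eq, hmat, posDef_borderedMatrix_iff, Set.mem_Ioi]
        constructor
        · rintro ⟨-, h⟩
          linarith
        · exact fun h => ⟨hA, by linarith⟩
      by_cases hx : x ∈ Set.Ioi (0 : ℝ)
      · rw [Set.indicator_of_mem (hiff.2 hx), Set.indicator_of_mem hx, hmat, hη', hθ',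
          ← ENNReal.ofReal_mul (by unfold potentialDensity; positivity),
          ← potentialDensity_borderedMatrix hA hx]
        congr 3
        ring
      · rw [Set.indicator_of_notMem (hiff.not.2 hx), Set.indicator_of_notMem hx]
    · rw [Set.indicator_of_notMem (by exact hA)]
      refine (lintegral_congr fun x => Set.indicator_of_notMem ?_ _).trans lintegral_zero
      rw [Set.mem_ofPred_eq, hmat, posDef_borderedMatrix_iff]
      exact fun h => hA h.1
  simp only [Function.comp_def, hinner]
  rw [lintegral_indicator (measurableSet_posDef_diagonal_sub W' hW'),
    lintegral_mul_const' _ _ ENNReal.ofReal_ne_top,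
    h W' (η' + t • w) θ' hW' (fun i j => hW0 _ _)
      (fun i => add_nonneg (hη _) (mul_nonneg ht.le (hW0 _ _))) (fun i => hθ _),
    Fintype.prod_sum_type]
  simp [θ', t]

theorem potentialMassFormula (α : Type*) [Fintype α] [DecidableEq α] :
    PotentialMassFormula α := by
  refine Fintype.induction_empty_option
    (P := fun α _ => ∀ [DecidableEq α], PotentialMassFormula α) ?_ ?_ ?_ α
  · intro α β _ e h _
    classical
    let _ : Fintype α := Fintype.ofEquiv β e.symm
    exact h.of_equiv e
  · exact potentialMassFormula_of_isEmpty
  · intro α _ h _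
    classical
    exact h.sum_unit.of_equiv (Equiv.optionEquivSumPUnit α).symm

theorem pin_self {V : Type*} [DecidableEq V] (r : V) (u : {i : V // i ≠ r} → ℝ) :
    pin r u r = 0 := by
  simp [pin]

theorem pin_coe {V : Type*} [DecidableEq V] {r : V} (u : {i : V // i ≠ r} → ℝ)
    (i : {i : V // i ≠ r}) : pin r u i = u i := by
  simp [pin, i.2]

/-- The weights restricted to the vertices other than `r`. -/
def innerWeights {V : Type*} (W : V → V → ℝ) (r : V) :
    Matrix {i : V // i ≠ r} {i : V // i ≠ r} ℝ :=
  Matrix.of fun i j => W i j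

theorem isSymm_innerWeights {V : Type*} {W : V → V → ℝ} (hW : ∀ i j, W i j = W j i)
    (r : V) : (innerWeights W r).IsSymm :=
  Matrix.IsSymm.ext fun _ _ => hW _ _

theorem propagate_of_connected {V : Type*} {W : V → V → ℝ} (hW : ∀ i j, W i j = W j i)
    (hconn : (SimpleGraph.fromRel fun i j => 0 < W i j).Connected) {P : V → Prop}
    (hP : ∀ i j, 0 < W i j → P i → P j) {i : V} (hi : P i) (j : V) : P j := by
  obtain ⟨p⟩ := hconn.preconnected i j
  induction p with
  | nil => exact hi
  | cons hadj _ ih =>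
    rw [SimpleGraph.fromRel_adj] at hadj
    refine ih (hP _ _ ?_ hi)
    rcases hadj.2 with h | h
    · exact h
    · rwa [hW]

section Environment

variable {V : Type*} [Fintype V] [DecidableEq V]

/-- The holding rates `∑ₖ Wᵢₖ exp (uₖ - uᵢ)` of the jump process in the environment `u`. -/
noncomputable def envPotential (W : V → V → ℝ) (r : V) (u : {i : V // i ≠ r} → ℝ) :
    {i : V // i ≠ r} → ℝ :=
  fun i => ∑ k, W i k * Real.exp (pin r u k - u i)

/-- The Schrödinger operator with potential `envPotential W r u`. -/
noncomputable def envOperator (W : V → V → ℝ) (r : V) (u : {i : V // i ≠ r} → ℝ) :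
    Matrix {i : V // i ≠ r} {i : V // i ≠ r} ℝ :=
  Matrix.diagonal (envPotential W r u) - innerWeights W r

theorem envPotential_eq (W : V → V → ℝ) (r : V) (u : {i : V // i ≠ r} → ℝ) (i : {i : V // i ≠ r}) :
    envPotential W r u i =
      W i r * Real.exp (-u i) + ∑ j : {i : V // i ≠ r}, W i j * Real.exp (u j - u i) := by
  rw [envPotential, Fintype.sum_eq_add_sum_subtype_ne _ r]
  simp only [pin_self, pin_coe, zero_sub]

theorem diagonal_sub_innerWeights_mulVec (W : V → V → ℝ) (r : V) (b x : {i : V // i ≠ r} → ℝ)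
    (i : {i : V // i ≠ r}) :
    ((Matrix.diagonal b - innerWeights W r).mulVec x) i =
      b i * x i - ∑ j : {i : V // i ≠ r}, W i j * x j := by
  rw [Matrix.sub_mulVec, Pi.sub_apply, Matrix.mulVec_diagonal]
  rfl

theorem envOperator_mulVec_exp (W : V → V → ℝ) (r : V) (u : {i : V // i ≠ r} → ℝ) :
    (envOperator W r u).mulVec (fun i => Real.exp (u i)) = fun i : {i : V // i ≠ r} => W i r := by
  ext i
  rw [envOperator, diagonal_sub_innerWeights_mulVec, envPotential_eq, add_mul, Finset.sum_mul]
  simp only [mul_assoc, ← Real.exp_add, neg_add_cancel, sub_add_cancel, Real.exp_zero, mul_one,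
    add_sub_cancel_right]

/-- The ground-state representation of the quadratic form of `envOperator`. -/
theorem dotProduct_envOperator_mulVec {W : V → V → ℝ} (hW : ∀ i j, W i j = W j i) (r : V)
    (u x : {i : V // i ≠ r} → ℝ) :
    x ⬝ᵥ (envOperator W r u).mulVec x =
      1 / 2 * ∑ i, ∑ j, W i j * Real.exp (pin r u i + pin r u j) *
        (pin r (fun i => x i * Real.exp (-u i)) i -
          pin r (fun i => x i * Real.exp (-u i)) j) ^ 2 := by
  set v := pin r u with hv
  set z := pin r (fun i => x i * Real.exp (-u i)) with hz
  set f : V → V → ℝ := fun i j => W i j * Real.exp (v i + v j) with hf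
  have hfs (i j) : f i j = f j i := by simp only [hf, hW i j, add_comm]
  have hsq : 1 / 2 * ∑ i, ∑ j, f i j * (z i - z j) ^ 2 =
      ∑ i, (z i ^ 2 * ∑ j, f i j - z i * ∑ j, f i j * z j) := by
    have hswap : ∑ i, ∑ j, f i j * z j ^ 2 = ∑ i, ∑ j, f i j * z i ^ 2 := by
      rw [Finset.sum_comm]
      simp only [hfs]
    have hexp : ∑ i, ∑ j, f i j * (z i - z j) ^ 2 = ∑ i, ∑ j, f i j * z i ^ 2 +
        ∑ i, ∑ j, f i j * z j ^ 2 - 2 * ∑ i, ∑ j, z i * (f i j * z j) := by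
      simp only [Finset.mul_sum, ← Finset.sum_add_distrib, ← Finset.sum_sub_distrib]
      exact Finset.sum_congr rfl fun i _ => Finset.sum_congr rfl fun j _ => by ring
    have hdiag : ∑ i, z i ^ 2 * ∑ j, f i j = ∑ i, ∑ j, f i j * z i ^ 2 := by
      simp only [mul_comm (z _ ^ 2), Finset.sum_mul]
    have hoff : ∑ i, z i * ∑ j, f i j * z j = ∑ i, ∑ j, z i * (f i j * z j) := by
      simp only [Finset.mul_sum]
    rw [hexp, hswap, Finset.sum_sub_distrib, hdiag, hoff]
    ring
  rw [hsq, Fintype.sum_eq_add_sum_subtype_ne _ r, hz, pin_self, dotProduct]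
  simp only [pin_coe, ne_eq, OfNat.ofNat_ne_zero, not_false_eq_true, zero_pow, zero_mul, sub_zero,
    zero_add]
  refine Finset.sum_congr rfl fun i _ => ?_
  rw [envOperator, diagonal_sub_innerWeights_mulVec,
    Fintype.sum_eq_add_sum_subtype_ne (fun j => f i j * _) r, pin_self]
  simp only [pin_coe, mul_zero, zero_add, hf, hv, envPotential, Finset.mul_sum,
    Finset.sum_mul, mul_sub]
  congr 1
  · refine Finset.sum_congr rfl fun k _ => ?_
    rw [Real.exp_sub, Real.exp_add, Real.exp_neg]
    field_simp
  · refine Finset.sum_congr rfl fun k _ => ?_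
    rw [Real.exp_add, Real.exp_neg, Real.exp_neg]
    field_simp

theorem posDef_envOperator {W : V → V → ℝ} (hW : ∀ i j, W i j = W j i) (hnn : ∀ i j, 0 ≤ W i j)
    (hconn : (SimpleGraph.fromRel fun i j => 0 < W i j).Connected) (r : V)
    (u : {i : V // i ≠ r} → ℝ) : (envOperator W r u).PosDef := by
  refine .of_dotProduct_mulVec_pos ?_ fun x hx => ?_
  · rw [Matrix.IsHermitian, Matrix.conjTranspose_eq_transpose_of_trivial, envOperator,
      Matrix.transpose_sub, Matrix.diagonal_transpose, (isSymm_innerWeights hW r).eq]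
  rw [star_trivial, dotProduct_envOperator_mulVec hW]
  set z := pin r (fun i => x i * Real.exp (-u i)) with hz
  have hterm (i j) : 0 ≤ W i j * Real.exp (pin r u i + pin r u j) * (z i - z j) ^ 2 :=
    mul_nonneg (mul_nonneg (hnn i j) (Real.exp_pos _).le) (sq_nonneg _)
  refine mul_pos (by norm_num) ((Finset.sum_nonneg fun i _ =>
    Finset.sum_nonneg fun j _ => hterm i j).lt_of_ne fun h => hx ?_)
  have hzero (i j) : W i j * Real.exp (pin r u i + pin r u j) * (z i - z j) ^ 2 = 0 :=
    (Finset.sum_eq_zero_iff_of_nonneg fun j _ => hterm i j).1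
      ((Finset.sum_eq_zero_iff_of_nonneg fun i _ => Finset.sum_nonneg fun j _ => hterm i j).1
        h.symm i (Finset.mem_univ i)) j (Finset.mem_univ j)
  have hz0 := propagate_of_connected (P := fun i => z i = 0) hW hconn (fun i j hij hi => by
    simpa [hij.ne', hi] using hzero i j) (pin_self r _)
  ext i
  simpa [hz, pin_coe] using hz0 i

theorem envPotential_injective {W : V → V → ℝ} (hW : ∀ i j, W i j = W j i)
    (hnn : ∀ i j, 0 ≤ W i j) (hconn : (SimpleGraph.fromRel fun i j => 0 < W i j).Connected)
    (r : V) : Function.Injective (envPotential W r) := by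
  intro u u' h
  have hop : envOperator W r u = envOperator W r u' := by rw [envOperator, h, envOperator]
  have hexp := (inv_mulVec_eq_of_mulVec_eq (posDef_envOperator hW hnn hconn r u)
    (envOperator_mulVec_exp W r u)).symm.trans (hop ▸ inv_mulVec_eq_of_mulVec_eq
      (posDef_envOperator hW hnn hconn r u') (envOperator_mulVec_exp W r u'))
  ext i
  exact Real.exp_injective (congrFun hexp i)

theorem range_envPotential {W : V → V → ℝ} (hW : ∀ i j, W i j = W j i) (hnn : ∀ i j, 0 ≤ W i j)
    (hconn : (SimpleGraph.fromRel fun i j => 0 < W i j).Connected) (r : V) :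
    Set.range (envPotential W r) = {b | (Matrix.diagonal b - innerWeights W r).PosDef} := by
  refine Set.Subset.antisymm ?_ fun b hb => ?_
  · rintro _ ⟨u, rfl⟩
    exact posDef_envOperator hW hnn hconn r u
  replace hb : (Matrix.diagonal b - innerWeights W r).PosDef := hb
  set x := (Matrix.diagonal b - innerWeights W r)⁻¹.mulVec fun i : {i : V // i ≠ r} => W i r with hx
  have hHx (i : {i : V // i ≠ r}) : b i * x i - ∑ j : {i : V // i ≠ r}, W i j * x j = W i r := by
    rw [← diagonal_sub_innerWeights_mulVec, hx, mulVec_inv_mulVec hb]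
  have hx0 (i) : 0 ≤ x i := by
    refine hb.nonneg_of_mulVec_nonneg (fun i j hij => ?_) (fun i => ?_) i
    · simpa [Matrix.diagonal_apply_ne _ hij, innerWeights] using hnn _ _
    · rw [hx, mulVec_inv_mulVec hb]
      exact hnn _ _
  have hxpos (i) : 0 < x i := by
    refine (hx0 i).lt_of_ne fun hi => ?_
    have hbad := propagate_of_connected (P := fun k => ∃ h : k ≠ r, x ⟨k, h⟩ = 0) hW hconn
      (fun k l hkl ⟨hk, hxk⟩ => ?_) ⟨i.2, hi.symm⟩ r
    · exact hbad.1 rfl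
    have hsum := hHx ⟨k, hk⟩
    have hnonneg (j : {i : V // i ≠ r}) : 0 ≤ W k j * x j := mul_nonneg (hnn _ _) (hx0 _)
    have hs0 : 0 ≤ ∑ j : {i : V // i ≠ r}, W k j * x j := Finset.sum_nonneg fun j _ => hnonneg j
    rw [hxk, mul_zero, zero_sub] at hsum
    have hkr := hnn k r
    have hl : l ≠ r := by
      rintro rfl
      linarith
    have hs : ∑ j : {i : V // i ≠ r}, W k j * x j = 0 := by linarith
    have := (Finset.sum_eq_zero_iff_of_nonneg fun j _ => hnonneg j).1 hs ⟨l, hl⟩ (Finset.mem_univ _)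
    exact ⟨hl, (mul_eq_zero.1 this).resolve_left hkl.ne'⟩
  refine ⟨fun i => Real.log (x i), ?_⟩
  ext i
  rw [envPotential_eq, Real.exp_neg, Real.exp_log (hxpos i)]
  simp only [Real.exp_sub, Real.exp_log (hxpos _), ← mul_div_assoc]
  rw [← Finset.sum_div, ← div_eq_mul_inv, ← add_div, div_eq_iff (hxpos i).ne']
  linarith [hHx i]

theorem hasFDerivAt_envPotential (W : V → V → ℝ) (r : V) (u : {i : V // i ≠ r} → ℝ) :
    HasFDerivAt (envPotential W r)
      (LinearMap.toContinuousLinearMap (Matrix.toLin'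
        (-(Matrix.diagonal (fun i => Real.exp (-u i)) * envOperator W r u *
          Matrix.diagonal fun i => Real.exp (u i))))) u := by
  rw [hasFDerivAt_pi']
  intro i
  have hproj (j : {i : V // i ≠ r}) : HasFDerivAt (fun u : {i : V // i ≠ r} → ℝ => u j)
      (ContinuousLinearMap.proj (R := ℝ) (φ := fun _ : {i : V // i ≠ r} => ℝ) j) u :=
    hasFDerivAt_apply j u
  have hder := ((hproj i).neg.exp.const_mul (W i r)).add
    (HasFDerivAt.fun_sum (u := Finset.univ) fun j _ =>
      ((hproj j).sub (hproj i)).exp.const_mul (W i j))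
  simp only [envPotential_eq]
  refine hder.congr_fderiv ?_
  ext h
  have hsum : ∑ j : {i : V // i ≠ r}, W i j * (Real.exp (u j - u i) * (h j - h i)) =
      Real.exp (-u i) * ∑ j : {i : V // i ≠ r}, W i j * (Real.exp (u j) * h j) -
        (∑ j : {i : V // i ≠ r}, W i j * Real.exp (u j - u i)) * h i := by
    rw [Finset.mul_sum, Finset.sum_mul, ← Finset.sum_sub_distrib]
    refine Finset.sum_congr rfl fun j _ => ?_
    rw [sub_eq_add_neg (u j), Real.exp_add]
    ring
  have hexp : Real.exp (-u i) * Real.exp (u i) = 1 := by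
    rw [← Real.exp_add, neg_add_cancel, Real.exp_zero]
  suffices -(W i r * (Real.exp (-u i) * h i)) +
        ∑ j : {i : V // i ≠ r}, W i j * (Real.exp (u j - u i) * (h j - h i)) =
      -((Matrix.diagonal (fun i => Real.exp (-u i)) * (envOperator W r u *
        Matrix.diagonal fun i => Real.exp (u i))).mulVec h i) by simpa
  rw [hsum, ← Matrix.mulVec_mulVec, ← Matrix.mulVec_mulVec, Matrix.mulVec_diagonal, envOperator,
    diagonal_sub_innerWeights_mulVec, envPotential_eq]
  simp only [Matrix.mulVec_diagonal]
  linear_combination (W i r * Real.exp (-u i) +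
    ∑ j : {i : V // i ≠ r}, W i j * Real.exp (u j - u i)) * h i * hexp

theorem abs_det_fderiv_envPotential {W : V → V → ℝ} (hW : ∀ i j, W i j = W j i)
    (hnn : ∀ i j, 0 ≤ W i j) (hconn : (SimpleGraph.fromRel fun i j => 0 < W i j).Connected) (r : V)
    (u : {i : V // i ≠ r} → ℝ) :
    |(LinearMap.toContinuousLinearMap (Matrix.toLin'
        (-(Matrix.diagonal (fun i => Real.exp (-u i)) * envOperator W r u *
          Matrix.diagonal fun i => Real.exp (u i))))).det| = (envOperator W r u).det := by
  rw [LinearMap.det_toContinuousLinearMap, LinearMap.det_toLin', Matrix.det_neg, abs_mul, abs_pow,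
    abs_neg, abs_one, one_pow, one_mul, Matrix.det_mul, Matrix.det_mul, Matrix.det_diagonal,
    Matrix.det_diagonal, mul_right_comm, ← Finset.prod_mul_distrib]
  simp only [← Real.exp_add, neg_add_cancel, Real.exp_zero, Finset.prod_const_one, one_mul]
  exact abs_of_pos (posDef_envOperator hW hnn hconn r u).det_pos

theorem treeGen_pin {W : V → V → ℝ} (hW : ∀ i j, W i j = W j i) (r : V)
    (u : {i : V // i ≠ r} → ℝ) :
    treeGen W (pin r u) hW = (∏ i, Real.exp (u i)) ^ 2 * (envOperator W r u).det := by
  rw [treeGen, ← det_diagonal_sub_eq_treePoly r]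
  have hconj : (Matrix.diagonal (fun i : {i : V // i ≠ r} =>
        ∑ k, W i k * Real.exp (pin r u i + pin r u k)) -
      Matrix.of fun i j : {i : V // i ≠ r} => W i j * Real.exp (pin r u i + pin r u j)) =
      Matrix.diagonal (fun i => Real.exp (u i)) * envOperator W r u *
        Matrix.diagonal fun i => Real.exp (u i) := by
    ext i j
    rw [Matrix.mul_diagonal, Matrix.diagonal_mul, envOperator, Matrix.sub_apply, Matrix.sub_apply,
      Matrix.of_apply, mul_sub, sub_mul, pin_coe, pin_coe]
    congr 1
    · rcases eq_or_ne i j with rfl | hij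
      · rw [Matrix.diagonal_apply_eq, Matrix.diagonal_apply_eq, envPotential, Finset.mul_sum,
          Finset.sum_mul]
        refine Finset.sum_congr rfl fun k _ => ?_
        rw [pin_coe, Real.exp_add, Real.exp_sub]
        field_simp
      · simp [Matrix.diagonal_apply_ne _ hij]
    · rw [Real.exp_add, innerWeights, Matrix.of_apply]
      ring
  rw [hconj, Matrix.det_mul, Matrix.det_mul, Matrix.det_diagonal]
  ring

theorem pairSum_eq_potentialEnergy {W : V → V → ℝ} (hW : ∀ i j, W i j = W j i)
    (hnn : ∀ i j, 0 ≤ W i j) (hdiag : ∀ i, W i i = 0)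
    (hconn : (SimpleGraph.fromRel fun i j => 0 < W i j).Connected) (ϑ : V → ℝ) (r : V)
    (u : {i : V // i ≠ r} → ℝ) :
    pairSum (fun i j => W i j * (Real.exp (pin r u i - pin r u j) * ϑ j ^ 2 +
        Real.exp (pin r u j - pin r u i) * ϑ i ^ 2 - 2 * (ϑ i * ϑ j))) =
      potentialEnergy (envOperator W r u) (fun i => ϑ r * W i r)
        fun i => ϑ i := by
  set v := pin r u with hv
  have hinv : (envOperator W r u)⁻¹.mulVec (fun i => ϑ r * W i r) =
      fun i => ϑ r * Real.exp (u i) := by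
    refine inv_mulVec_eq_of_mulVec_eq (posDef_envOperator hW hnn hconn r u) ?_
    have h := congrArg (fun x => ϑ r • x) (envOperator_mulVec_exp W r u)
    simp only [← Matrix.mulVec_smul] at h
    exact h
  have hfull : pairSum (fun i j => W i j * (Real.exp (v i - v j) * ϑ j ^ 2 +
        Real.exp (v j - v i) * ϑ i ^ 2 - 2 * (ϑ i * ϑ j))) =
      ∑ i, (ϑ i ^ 2 * ∑ j, W i j * Real.exp (v j - v i) - ϑ i * ∑ j, W i j * ϑ j) := by
    have hall (f : V → V → ℝ) (hf : ∀ i, f i i = 0) : pairSum f = 1 / 2 * ∑ i, ∑ j, f i j := by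
      rw [pairSum, ← Fintype.sum_prod_type']
      congr 1
      refine Finset.sum_subset (Finset.subset_univ _) fun p _ hp => ?_
      have hp' : p.1 = p.2 := by simpa using hp
      rw [hp', hf]
    have hswap : ∑ i, ∑ j, W i j * (Real.exp (v i - v j) * ϑ j ^ 2) =
        ∑ i, ∑ j, W i j * (Real.exp (v j - v i) * ϑ i ^ 2) := by
      rw [Finset.sum_comm]
      exact Finset.sum_congr rfl fun i _ => Finset.sum_congr rfl fun j _ => by rw [hW j i]
    have hsq : ∑ i, ϑ i ^ 2 * ∑ j, W i j * Real.exp (v j - v i) =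
        ∑ i, ∑ j, W i j * (Real.exp (v j - v i) * ϑ i ^ 2) := by
      simp only [Finset.mul_sum]
      exact Finset.sum_congr rfl fun i _ => Finset.sum_congr rfl fun j _ => by ring
    have hcross : ∑ i, ∑ j, W i j * (2 * (ϑ i * ϑ j)) = 2 * ∑ i, ϑ i * ∑ j, W i j * ϑ j := by
      simp only [Finset.mul_sum]
      exact Finset.sum_congr rfl fun i _ => Finset.sum_congr rfl fun j _ => by ring
    rw [hall _ fun i => by rw [hdiag, zero_mul]]
    simp only [mul_sub, mul_add, Finset.sum_sub_distrib, Finset.sum_add_distrib]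
    rw [hswap, hsq, hcross]
    ring
  rw [hfull, potentialEnergy, hinv, Fintype.sum_eq_add_sum_subtype_ne _ r]
  have hroot : ∑ j, W r j * Real.exp (v j - v r) =
      ∑ j : {i : V // i ≠ r}, W j r * Real.exp (u j) := by
    rw [Fintype.sum_eq_add_sum_subtype_ne _ r, hdiag, zero_mul, zero_add]
    simp only [hv, pin_self, pin_coe, sub_zero, hW r]
  have hroot' : ∑ j, W r j * ϑ j = ∑ j : {i : V // i ≠ r}, W j r * ϑ j := by
    rw [Fintype.sum_eq_add_sum_subtype_ne _ r, hdiag, zero_mul, zero_add]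
    simp only [hW r]
  rw [hroot, hroot', dotProduct, dotProduct, dotProduct]
  simp only [Finset.mul_sum, ← Finset.sum_add_distrib, ← Finset.sum_sub_distrib]
  refine Finset.sum_congr rfl fun i _ => ?_
  rw [envOperator, diagonal_sub_innerWeights_mulVec, envPotential, Finset.sum_sub_distrib,
    ← Finset.mul_sum, ← Finset.mul_sum,
    Fintype.sum_eq_add_sum_subtype_ne (fun j => W i j * ϑ j) r, hv, pin_coe]
  ring

theorem mixDensity_nonneg {W : V → V → ℝ} (hW : ∀ i j, W i j = W j i) {ϑ : V → ℝ}
    (hϑ : ∀ i, 0 < ϑ i) (r : V) (u : V → ℝ) : 0 ≤ mixDensity W hW ϑ r u :=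
  mul_nonneg (mul_nonneg (Real.exp_pos _).le (Real.sqrt_nonneg _))
    (Finset.prod_nonneg fun i _ => div_nonneg (mul_nonneg (hϑ i).le (Real.exp_pos _).le)
      (Real.sqrt_nonneg _))

theorem mixDensity_pin {W : V → V → ℝ} (hW : ∀ i j, W i j = W j i) (hnn : ∀ i j, 0 ≤ W i j)
    (hdiag : ∀ i, W i i = 0) (hconn : (SimpleGraph.fromRel fun i j => 0 < W i j).Connected)
    (ϑ : V → ℝ) (r : V) (u : {i : V // i ≠ r} → ℝ) :
    mixDensity W hW ϑ r (pin r u) =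
      (envOperator W r u).det *
        potentialDensity (envOperator W r u) (fun i => ϑ r * W i r) (fun i => ϑ i) *
        ∏ i : {i : V // i ≠ r}, ϑ i / √(2 * Real.pi) := by
  have hdet := (posDef_envOperator hW hnn hconn r u).det_pos
  have hprod : ∏ i ∈ Finset.univ.filter (fun i => i ≠ r),
      (ϑ i * Real.exp (-pin r u i) / √(2 * Real.pi)) =
      (∏ i, Real.exp (u i))⁻¹ * ∏ i : {i : V // i ≠ r}, ϑ i / √(2 * Real.pi) := by
    rw [Finset.prod_subtype (p := fun i => i ≠ r) _ (by simp), ← Finset.prod_inv_distrib,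
      ← Finset.prod_mul_distrib]
    refine Finset.prod_congr rfl fun i _ => ?_
    rw [pin_coe, Real.exp_neg]
    ring
  have hexp : 0 < ∏ i, Real.exp (u i) := Finset.prod_pos fun i _ => Real.exp_pos _
  rw [mixDensity, pairSum_eq_potentialEnergy hW hnn hdiag hconn, treeGen_pin, hprod,
    Real.sqrt_mul (sq_nonneg _), Real.sqrt_sq hexp.le, potentialDensity]
  have hsqrt0 := (Real.sqrt_pos.2 hdet).ne'
  field_simp
  rw [Real.sq_sqrt hdet.le, mul_comm]

theorem continuous_mixDensity_pin {W : V → V → ℝ} (hW : ∀ i j, W i j = W j i) (ϑ : V → ℝ) (r : V) :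
    Continuous fun u : {i : V // i ≠ r} → ℝ => mixDensity W hW ϑ r (pin r u) := by
  have hpin (i : V) : Continuous fun u : {i : V // i ≠ r} → ℝ => pin r u i := by
    by_cases h : i = r
    · simpa [pin, h] using continuous_const
    · simpa [pin, h] using continuous_apply _
  have htree : Continuous fun u : {i : V // i ≠ r} → ℝ => treeGen W (pin r u) hW := by
    refine continuous_finsetSum _ fun T _ => continuous_finsetProd _ fun e _ => ?_
    induction e with
    | h i j =>
      simp only [Sym2.lift_mk]
      fun_prop
  simp only [mixDensity, pairSum]
  fun_prop

theorem lintegral_mixDensity_pin {W : V → V → ℝ} (hW : ∀ i j, W i j = W j i)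
    (hnn : ∀ i j, 0 ≤ W i j) (hdiag : ∀ i, W i i = 0)
    (hconn : (SimpleGraph.fromRel fun i j => 0 < W i j).Connected) {ϑ : V → ℝ}
    (hϑ : ∀ i, 0 < ϑ i) (r : V) :
    ∫⁻ u : {i : V // i ≠ r} → ℝ, ENNReal.ofReal (mixDensity W hW ϑ r (pin r u)) = 1 := by
  have hmass := potentialMassFormula {i : V // i ≠ r} (innerWeights W r) (fun i => ϑ r * W i r)
    (fun i => ϑ i) (isSymm_innerWeights hW r) (fun _ _ => hnn _ _)
    (fun _ => mul_nonneg (hϑ r).le (hnn _ _)) fun _ => hϑ _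
  rw [← range_envPotential hW hnn hconn r, ← Set.image_univ,
    lintegral_image_eq_lintegral_abs_det_fderiv_mul volume MeasurableSet.univ
      (fun u _ => (hasFDerivAt_envPotential W r u).hasFDerivWithinAt)
      (envPotential_injective hW hnn hconn r).injOn, setLIntegral_univ] at hmass
  have hsplit (u : {i : V // i ≠ r} → ℝ) : ENNReal.ofReal (mixDensity W hW ϑ r (pin r u)) =
      ENNReal.ofReal (envOperator W r u).det * ENNReal.ofReal (potentialDensity
        (envOperator W r u) (fun i => ϑ r * W i r) (fun i => ϑ i)) *
        ∏ i : {i : V // i ≠ r}, ENNReal.ofReal (ϑ i / √(2 * Real.pi)) := by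
    have hdet := (posDef_envOperator hW hnn hconn r u).det_pos.le
    rw [mixDensity_pin hW hnn hdiag hconn, ENNReal.ofReal_mul (mul_nonneg hdet
      (by unfold potentialDensity; positivity)), ENNReal.ofReal_mul hdet,
      ENNReal.ofReal_prod_of_nonneg fun i _ => div_nonneg (hϑ i.1).le (Real.sqrt_nonneg _)]
  simp only [abs_det_fderiv_envPotential hW hnn hconn] at hmass
  have hfin : ∏ i : {i : V // i ≠ r}, ENNReal.ofReal (ϑ i / √(2 * Real.pi)) ≠ ∞ :=
    ENNReal.prod_ne_top fun i _ => ENNReal.ofReal_ne_top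
  simp only [hsplit]
  rw [lintegral_mul_const' _ _ hfin]
  refine (congrArg (· * _) hmass).trans ?_
  rw [← Finset.prod_mul_distrib]
  refine Finset.prod_eq_one fun i _ => ?_
  have hpi : √(2 * Real.pi) ≠ 0 := by positivity
  rw [← ENNReal.ofReal_mul (div_nonneg (Real.sqrt_nonneg _) (hϑ i).le),
    div_mul_div_cancel₀ (hϑ i).ne', div_self hpi, ENNReal.ofReal_one]

end Environment

/-- **The mixing density is a probability density** (Statement 5).
For symmetric, nonnegative, connected weights `W` and positive initial local times `ϑ`,
the mixing density `ρ^{W,ϑ}_{i₀}` integrates to `1` over `{u : u_{i₀} = 0}`. -/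
theorem mixDensity_integral_eq_one {V : Type*} [Fintype V] [DecidableEq V] [Nonempty V]
    (W : V → V → ℝ) (hW : ∀ i j, W i j = W j i)
    (hnn : ∀ i j, 0 ≤ W i j) (hdiag : ∀ i, W i i = 0)
    (hconn : (SimpleGraph.fromRel (fun i j => 0 < W i j)).Connected)
    (ϑ : V → ℝ) (hϑ : ∀ i, 0 < ϑ i) (i₀ : V) :
    (∫ u : {i : V // i ≠ i₀} → ℝ, mixDensity W hW ϑ i₀ (pin i₀ u)) = 1 := by
  rw [integral_eq_lintegral_of_nonneg_ae
    (Filter.Eventually.of_forall fun u => mixDensity_nonneg hW hϑ i₀ _)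
    (continuous_mixDensity_pin hW ϑ i₀).aestronglyMeasurable,
    lintegral_mixDensity_pin hW hnn hdiag hconn hϑ i₀, ENNReal.toReal_one]
end

section
/- Let V be a finite set, let W : V × V → ℝ be symmetric with W_{ii} = 0, let u, x, y : V → ℝ, and let g : V × V → ℝ be symmetric. Suppose z : V → ℝ satisfies z_i² = x_i² + y_i² + g_{ii} + 1 for every i ∈ V. Then Σ_{{i,j}} W_{ij}(x_i x_j + y_i y_j − z_i z_j + g_{ij} + 1) − (1/2) Σ_{{i,j}} W_{ij}(e^{u_j−u_i} z_i² + e^{u_i−u_j} z_j² − 2 z_i z_j) = −(1/2) Σ_{{i,j}} W_{ij}(e^{u_j−u_i} + e^{u_i−u_j} − 2) − (1/2) Q, where Q = Σ_{i∈V} (Σ_{k≠i} W_{ik} e^{u_k−u_i})(x_i² + y_i² + g_{ii}) − 2 Σ_{{i,j}} W_{ij}(x_i x_j + y_i y_j + g_{ij}), and all sums Σ_{{i,j}} run over unordered pairs of distinct vertices of V. -/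
/-- Summing `F i k` over all ordered pairs of distinct vertices is the pair sum of the
symmetrization of `F`. -/
lemma sum_sum_ne_eq_pairSum {V : Type*} [Fintype V] [DecidableEq V] (F : V → V → ℝ) :
    ∑ i, ∑ k ∈ Finset.univ.filter (fun k => k ≠ i), F i k
      = pairSum (fun i j => F i j + F j i) := by
  have key : ∑ i, ∑ k ∈ Finset.univ.filter (fun k => k ≠ i), F i k
      = ∑ p ∈ Finset.univ.offDiag, F p.1 p.2 :=
    (Finset.sum_finset_product' _ _ (fun i => Finset.univ.filter (fun k => k ≠ i))
      fun p => by simp [eq_comm]).symm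
  have swap : ∑ p ∈ (Finset.univ : Finset V).offDiag, F p.2 p.1
      = ∑ p ∈ Finset.univ.offDiag, F p.1 p.2 :=
    Finset.sum_equiv (Equiv.prodComm V V) (fun p => by simp [eq_comm]) fun p _ => rfl
  rw [key, pairSum, Finset.sum_add_distrib, swap]
  ring

/-- **Key algebraic cancellation in the supersymmetric Bayes formula** (Statement 6).
With `g` encoding the symmetrized fermionic pairings and `z_i² = x_i² + y_i² + g_{ii} + 1`,
the H^{2|2} energy combined with the exponent of the mixing density with initial local
times `z` reduces to the `u`-twisted free-field quadratic form plus the exponent of the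
mixing density with unit initial local times. All pair sums run over unordered pairs of
distinct vertices. -/
theorem susy_bayes_exponent {V : Type*} [Fintype V] [DecidableEq V]
    (W : V → V → ℝ) (hW : ∀ i j, W i j = W j i) (hdiag : ∀ i, W i i = 0)
    (u x y : V → ℝ) (g : V → V → ℝ) (hg : ∀ i j, g i j = g j i)
    (z : V → ℝ) (hz : ∀ i, z i ^ 2 = x i ^ 2 + y i ^ 2 + g i i + 1) :
    pairSum (fun i j => W i j * (x i * x j + y i * y j - z i * z j + g i j + 1))
      - (1 / 2) * pairSum (fun i j =>
          W i j * (Real.exp (u j - u i) * z i ^ 2 + Real.exp (u i - u j) * z j ^ 2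
            - 2 * (z i * z j)))
    = -(1 / 2) * pairSum (fun i j =>
          W i j * (Real.exp (u j - u i) + Real.exp (u i - u j) - 2))
      - (1 / 2) * ((∑ i, (∑ k ∈ Finset.univ.filter (fun k => k ≠ i),
              W i k * Real.exp (u k - u i)) * (x i ^ 2 + y i ^ 2 + g i i))
          - 2 * pairSum (fun i j => W i j * (x i * x j + y i * y j + g i j))) := by
  simp_rw [Finset.sum_mul]
  rw [sum_sum_ne_eq_pairSum]
  simp only [pairSum, Finset.mul_sum, ← Finset.sum_sub_distrib]
  refine Finset.sum_congr rfl fun p _ => ?_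
  rw [hz p.1, hz p.2, hW p.2 p.1]
  ring
end

section
/- Let V be a finite set, let δ, a ∈ V, and let W : V × V → ℝ be symmetric, nonnegative, with zero diagonal. Let x, y, u : V → ℝ satisfy x_δ = y_δ = 0 and u_a = 0, and let g : V × V → ℝ be symmetric with g_{iδ} = 0 for all i and x_i² + y_i² + g_{ii} + 1 > 0 for all i; set z_i = √(x_i² + y_i² + g_{ii} + 1), so that z_δ = 1. Then (z_a/z_δ) · exp(Σ_{{i,j}} W_{ij}(x_i x_j + y_i y_j − z_i z_j + g_{ij} + 1)) · (∏_{i∈V∖{δ}} z_i^{−1}) · ρ^{W,z}_a(u) = exp(−(1/2) Q^u(x,y,g)) · ρ^{W,1}_a(u), where Q^u(x,y,g) = Σ_{i∈V}(Σ_{k≠i} W_{ik} e^{u_k−u_i})(x_i² + y_i² + g_{ii}) − 2 Σ_{{i,j}} W_{ij}(x_i x_j + y_i y_j + g_{ij}), ρ^{W,ϑ}_a(u) = exp(−(1/2) Σ_{{i,j}} W_{ij}(e^{u_i−u_j} ϑ_j² + e^{u_j−u_i} ϑ_i² − 2 ϑ_i ϑ_j)) · √(D(W,u)) · ∏_{i∈V∖{a}}(ϑ_i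 e^{−u_i}/√(2π)), D(W,u) = Σ_T ∏_{{i,j}∈E(T)} W_{ij} e^{u_i+u_j} (sum over all spanning trees T of the complete graph on V), and all sums Σ_{{i,j}} run over unordered pairs of distinct vertices. -/
theorem sum_offDiag_swap {V : Type*} [Fintype V] [DecidableEq V] (f : V → V → ℝ) :
    ∑ p ∈ (Finset.univ : Finset V).offDiag, f p.2 p.1
      = ∑ p ∈ (Finset.univ : Finset V).offDiag, f p.1 p.2 :=
  Finset.sum_bij' (fun p _ => p.swap) (fun p _ => p.swap)
    (by simp [eq_comm]) (by simp [eq_comm]) (by simp) (by simp) (by simp)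

theorem sum_sum_ne_eq_sum_offDiag {V : Type*} [Fintype V] [DecidableEq V] (f : V → V → ℝ) :
    ∑ i, ∑ k ∈ Finset.univ.filter (fun k => k ≠ i), f i k
      = ∑ p ∈ (Finset.univ : Finset V).offDiag, f p.1 p.2 := by
  rw [Finset.sum_sigma']
  exact Finset.sum_bij' (fun p _ => (p.1, p.2)) (fun p _ => ⟨p.1, p.2⟩)
    (by simp [eq_comm]) (by simp [eq_comm]) (by simp) (by simp) (by simp)

/-- The weighted sum over unordered pairs, collected by the vertex carrying the weight. -/
theorem pairSum_exp_sub_mul {V : Type*} [Fintype V] [DecidableEq V]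
    (W : V → V → ℝ) (hW : ∀ i j, W i j = W j i) (u q : V → ℝ) :
    pairSum (fun i j => W i j * (Real.exp (u i - u j) * q j + Real.exp (u j - u i) * q i))
      = ∑ i, (∑ k ∈ Finset.univ.filter (fun k => k ≠ i),
          W i k * Real.exp (u k - u i)) * q i := by
  simp_rw [Finset.sum_mul]
  rw [sum_sum_ne_eq_sum_offDiag (fun i k => W i k * Real.exp (u k - u i) * q i)]
  have hswap := sum_offDiag_swap (fun i k => W i k * Real.exp (u k - u i) * q i)
  simp only [pairSum, mul_add, Finset.sum_add_distrib]
  have hW' : ∀ p : V × V, W p.1 p.2 * (Real.exp (u p.1 - u p.2) * q p.2)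
      = W p.2 p.1 * Real.exp (u p.1 - u p.2) * q p.2 := fun p => by rw [hW p.1 p.2, mul_assoc]
  simp only [hW', hswap, ← mul_assoc]
  ring

theorem pairSum_add {V : Type*} [Fintype V] [DecidableEq V] (f h : V → V → ℝ) :
    pairSum (fun i j => f i j + h i j) = pairSum f + pairSum h := by
  simp only [pairSum, Finset.sum_add_distrib, mul_add]

theorem pairSum_sub {V : Type*} [Fintype V] [DecidableEq V] (f h : V → V → ℝ) :
    pairSum (fun i j => f i j - h i j) = pairSum f - pairSum h := by
  simp only [pairSum, Finset.sum_sub_distrib, mul_sub]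

theorem pairSum_const_mul {V : Type*} [Fintype V] [DecidableEq V] (c : ℝ) (f : V → V → ℝ) :
    pairSum (fun i j => c * f i j) = c * pairSum f := by
  simp only [pairSum, ← Finset.mul_sum, mul_left_comm]

/-- **Pointwise (integrand-level) supersymmetric Bayes formula** (Statement 7).
With `z_i = √(x_i² + y_i² + g_{ii} + 1)` (so `z_δ = 1`), `x_δ = y_δ = 0`, `g_{iδ} = 0`
and `u_a = 0`, the product of the bosonic H^{2|2} density pinned at `δ`, the prefactor
`z_a / z_δ`, and the mixing density with initial local times `z` pinned at `a` equals
the product of the `u`-twisted free-field density and the mixing density with unit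
initial local times pinned at `a`. -/
theorem susy_bayes_pointwise {V : Type*} [Fintype V] [DecidableEq V]
    (δ a : V) (W : V → V → ℝ) (hW : ∀ i j, W i j = W j i)
    (hnn : ∀ i j, 0 ≤ W i j) (hdiag : ∀ i, W i i = 0)
    (x y u : V → ℝ) (hxδ : x δ = 0) (hyδ : y δ = 0) (hua : u a = 0)
    (g : V → V → ℝ) (hg : ∀ i j, g i j = g j i) (hgδ : ∀ i, g i δ = 0)
    (hpos : ∀ i, 0 < x i ^ 2 + y i ^ 2 + g i i + 1)
    (z : V → ℝ) (hz : ∀ i, z i = Real.sqrt (x i ^ 2 + y i ^ 2 + g i i + 1)) :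
    (z a / z δ)
      * Real.exp (pairSum (fun i j =>
          W i j * (x i * x j + y i * y j - z i * z j + g i j + 1)))
      * (∏ i ∈ Finset.univ.filter (fun i => i ≠ δ), (z i)⁻¹)
      * mixDensity W hW z a u
    = Real.exp (-(1 / 2) * ((∑ i, (∑ k ∈ Finset.univ.filter (fun k => k ≠ i),
            W i k * Real.exp (u k - u i)) * (x i ^ 2 + y i ^ 2 + g i i))
        - 2 * pairSum (fun i j => W i j * (x i * x j + y i * y j + g i j))))
      * mixDensity W hW (fun _ => 1) a u := by
  have hzpos : ∀ i, 0 < z i := fun i => by rw [hz]; exact Real.sqrt_pos.mpr (hpos i)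
  have hzsq : ∀ i, z i ^ 2 = x i ^ 2 + y i ^ 2 + g i i + 1 := fun i => by
    rw [hz, Real.sq_sqrt (hpos i).le]
  have hprod : (z a / z δ) * (∏ i ∈ Finset.univ.filter (fun i => i ≠ δ), (z i)⁻¹)
      * ∏ i ∈ Finset.univ.filter (fun i => i ≠ a), z i = 1 := by
    have hall : ∀ b, z b * ∏ i ∈ Finset.univ.filter (fun i => i ≠ b), z i = ∏ i, z i := fun b => by
      rw [Finset.filter_ne', Finset.mul_prod_erase _ _ (Finset.mem_univ b)]
    have hne : ∏ i, z i ≠ 0 := Finset.prod_ne_zero_iff.mpr fun i _ => (hzpos i).ne'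
    rw [Finset.prod_inv_distrib]
    calc _ = (z a * ∏ i ∈ Finset.univ.filter (fun i => i ≠ a), z i)
          * (z δ * ∏ i ∈ Finset.univ.filter (fun i => i ≠ δ), z i)⁻¹ := by
          rw [mul_inv]; ring
      _ = 1 := by rw [hall, hall, mul_inv_cancel₀ hne]
  have hexp : pairSum (fun i j => W i j * (x i * x j + y i * y j - z i * z j + g i j + 1))
      + -(1 / 2) * pairSum (fun i j =>
        W i j * (Real.exp (u i - u j) * z j ^ 2 + Real.exp (u j - u i) * z i ^ 2
          - 2 * (z i * z j)))
      = -(1 / 2) * ((∑ i, (∑ k ∈ Finset.univ.filter (fun k => k ≠ i),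
            W i k * Real.exp (u k - u i)) * (x i ^ 2 + y i ^ 2 + g i i))
        - 2 * pairSum (fun i j => W i j * (x i * x j + y i * y j + g i j)))
      + -(1 / 2) * pairSum (fun i j =>
        W i j * (Real.exp (u i - u j) * (1 : ℝ) ^ 2 + Real.exp (u j - u i) * (1 : ℝ) ^ 2
          - 2 * ((1 : ℝ) * 1))) := by
    rw [← pairSum_exp_sub_mul W hW u (fun i => x i ^ 2 + y i ^ 2 + g i i), mul_sub, ← mul_assoc]
    simp only [← pairSum_const_mul, ← pairSum_sub, ← pairSum_add]
    congr 1
    funext i j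
    rw [hzsq, hzsq]
    ring
  simp only [mixDensity, mul_div_assoc, one_mul, Finset.prod_mul_distrib (f := z)]
  set P := ∏ i ∈ Finset.univ.filter (fun i => i ≠ a), Real.exp (-u i) / Real.sqrt (2 * Real.pi)
  rw [← mul_assoc (Real.exp (-(1 / 2) * (_ - _))), ← mul_assoc (Real.exp (-(1 / 2) * (_ - _))),
    ← Real.exp_add]
  simp only [mul_one] at hexp ⊢
  rw [← hexp, Real.exp_add]
  linear_combination
    (Real.exp (pairSum (fun i j => W i j * (x i * x j + y i * y j - z i * z j + g i j + 1)))
      * Real.exp (-(1 / 2) * pairSum (fun i j =>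
        W i j * (Real.exp (u i - u j) * z j ^ 2 + Real.exp (u j - u i) * z i ^ 2
          - 2 * (z i * z j))))
      * Real.sqrt (treeGen W u hW) * P) * hprod
end

section
/- Let V be a finite nonempty set, let Y : [0,∞) → V be measurable, and let ϑ : V → (0,∞). Define L_i(s) = ϑ_i + ∫₀^s 1{Y_τ = i} dτ, D(s) = Σ_{i∈V}(L_i(s)² − ϑ_i²), and let D^{-1} : [0,∞) → [0,∞) be the inverse of the (continuous, strictly increasing, surjective) function D. Define Z_t = Y_{D^{-1}(t)}. Then for every t ≥ 0 and every i ∈ V, ∫₀^t 1{Z_τ = i} dτ = L_i(D^{-1}(t))² − ϑ_i². -/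
/-- The accumulated local time `L_i(s) = ϑ_i + ∫₀^s 1{Y_τ = i} dτ` of the trajectory `Y`
at vertex `i`, with initial local time `ϑ_i`. -/
noncomputable def localTime {V : Type*} [DecidableEq V]
    (Y : ℝ → V) (ϑ : V → ℝ) (i : V) (s : ℝ) : ℝ :=
  ϑ i + ∫ τ in (0 : ℝ)..s, (if Y τ = i then (1 : ℝ) else 0)

/-- The Sabot–Tarrès time change `D(s) = Σ_i (L_i(s)² - ϑ_i²)`. -/
noncomputable def timeChange {V : Type*} [Fintype V] [DecidableEq V]
    (Y : ℝ → V) (ϑ : V → ℝ) (s : ℝ) : ℝ :=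
  ∑ i : V, (localTime Y ϑ i s ^ 2 - ϑ i ^ 2)

open MeasureTheory Set Filter Topology
open scoped NNReal

/-- A function on a subset of `ℝ` whose forward increments lie between `0` and `K` times the
increment of the argument is `K`-Lipschitz there. -/
theorem lipschitzOnWith_of_increments {f : ℝ → ℝ} {s : Set ℝ} {K : ℝ≥0}
    (h : ∀ a ∈ s, ∀ b ∈ s, a ≤ b → 0 ≤ f b - f a ∧ f b - f a ≤ K * (b - a)) :
    LipschitzOnWith K f s := by
  refine LipschitzOnWith.of_dist_le_mul fun a ha b hb => ?_
  rcases le_total a b with hab | hab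
  · rw [dist_comm, dist_comm a b, Real.dist_eq, Real.dist_eq, abs_of_nonneg (h a ha b hb hab).1,
      abs_of_nonneg (sub_nonneg.2 hab)]
    exact (h a ha b hb hab).2
  · rw [Real.dist_eq, Real.dist_eq, abs_of_nonneg (h b hb a ha hab).1,
      abs_of_nonneg (sub_nonneg.2 hab)]
    exact (h b hb a ha hab).2

/-- Lipschitz images of Lebesgue-null subsets of `ℝ` are null. -/
theorem LipschitzOnWith.volume_image_eq_zero {f : ℝ → ℝ} {s : Set ℝ} {K : ℝ≥0}
    (hf : LipschitzOnWith K f s) (hs : volume s = 0) : volume (f '' s) = 0 := by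
  have h := hf.hausdorffMeasure_image_le zero_le_one
  rw [hausdorffMeasure_real, hs, mul_zero] at h
  exact le_antisymm h zero_le

section LocalTime

variable {V : Type*} [DecidableEq V] {Y : ℝ → V} {ϑ : V → ℝ}

theorem localTime_zero (i : V) : localTime Y ϑ i 0 = ϑ i := by
  simp [localTime]

theorem timeChange_sub [Fintype V] (a b : ℝ) : timeChange Y ϑ b - timeChange Y ϑ a
    = ∑ i, (localTime Y ϑ i b ^ 2 - localTime Y ϑ i a ^ 2) := by
  rw [timeChange, timeChange, ← Finset.sum_sub_distrib]
  exact Finset.sum_congr rfl fun i _ => by ring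

theorem timeChange_zero [Fintype V] : timeChange Y ϑ 0 = 0 := by
  simp [timeChange, localTime_zero]

theorem hasDerivAt_timeChange [Fintype V] {s : ℝ}
    (h : ∀ i, HasDerivAt (localTime Y ϑ i) (if Y s = i then 1 else 0) s) :
    HasDerivAt (timeChange Y ϑ) (2 * localTime Y ϑ (Y s) s) s := by
  have hsum := HasDerivAt.fun_sum (u := Finset.univ)
    fun i _ => ((h i).fun_pow 2).sub_const (ϑ i ^ 2)
  convert! hsum using 1
  simp

variable [MeasurableSpace V] [MeasurableSingletonClass V]

theorem locallyIntegrable_occupation (hY : Measurable Y) (i : V) :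
    LocallyIntegrable (fun τ => if Y τ = i then (1 : ℝ) else 0) := by
  refine (locallyIntegrable_const (1 : ℝ)).mono
    (Measurable.ite (hY (measurableSet_singleton i)) measurable_const
      measurable_const).aestronglyMeasurable (Eventually.of_forall fun τ => ?_)
  split_ifs <;> simp

theorem localTime_sub_mem_Icc (hY : Measurable Y) (i : V) {a b : ℝ} (hab : a ≤ b) :
    localTime Y ϑ i b - localTime Y ϑ i a ∈ Icc 0 (b - a) := by
  have hocc (x y : ℝ) :
      IntervalIntegrable (fun τ => if Y τ = i then (1 : ℝ) else 0) volume x y :=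
    ((locallyIntegrable_occupation hY i).integrableOn_isCompact
      isCompact_uIcc).intervalIntegrable
  have hsub : localTime Y ϑ i b - localTime Y ϑ i a
      = ∫ τ in a..b, (if Y τ = i then (1 : ℝ) else 0) := by
    rw [localTime, localTime, add_sub_add_left_eq_sub,
      intervalIntegral.integral_interval_sub_left (hocc _ _) (hocc _ _)]
  rw [hsub]
  refine ⟨intervalIntegral.integral_nonneg hab fun τ _ => by split_ifs <;> simp, ?_⟩
  calc ∫ τ in a..b, (if Y τ = i then (1 : ℝ) else 0) ≤ ∫ _ in a..b, (1 : ℝ) :=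
        intervalIntegral.integral_mono_on hab (hocc _ _) intervalIntegrable_const
          fun τ _ => by split_ifs <;> simp
    _ = b - a := by simp

theorem le_localTime (hY : Measurable Y) (i : V) {s : ℝ} (hs : 0 ≤ s) :
    ϑ i ≤ localTime Y ϑ i s := by
  have h := (localTime_sub_mem_Icc (ϑ := ϑ) hY i hs).1
  rw [localTime_zero] at h
  linarith

theorem localTime_sq_sub_mem_Icc (hY : Measurable Y) (hϑ : ∀ i, 0 < ϑ i) (i : V) {a b : ℝ}
    (ha : 0 ≤ a) (hab : a ≤ b) :
    localTime Y ϑ i b ^ 2 - localTime Y ϑ i a ^ 2 ∈ Icc 0 (2 * (ϑ i + b) * (b - a)) := by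
  obtain ⟨h₀, h₁⟩ := localTime_sub_mem_Icc (ϑ := ϑ) hY i hab
  have hb := (localTime_sub_mem_Icc (ϑ := ϑ) hY i (ha.trans hab)).2
  rw [localTime_zero] at hb
  have hla := le_localTime (ϑ := ϑ) hY i ha
  have hϑi := hϑ i
  rw [sq_sub_sq, mem_Icc]
  refine ⟨mul_nonneg (by linarith) h₀, mul_le_mul (by linarith) h₁ h₀ (by linarith)⟩

theorem ae_forall_hasDerivAt_localTime [Countable V] (hY : Measurable Y) (ϑ : V → ℝ) :
    ∀ᵐ s, ∀ i, HasDerivAt (localTime Y ϑ i) (if Y s = i then 1 else 0) s := by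
  rw [ae_all_iff]
  intro i
  filter_upwards [LocallyIntegrable.ae_hasDerivAt_integral (locallyIntegrable_occupation hY i)] with s hs
  exact (hs 0).const_add (ϑ i)

variable [Fintype V]

theorem monotoneOn_timeChange (hY : Measurable Y) (hϑ : ∀ i, 0 < ϑ i) :
    MonotoneOn (timeChange Y ϑ) (Ici 0) := by
  intro a ha b _ hab
  rw [← sub_nonneg, timeChange_sub]
  exact Finset.sum_nonneg fun i _ => (localTime_sq_sub_mem_Icc hY hϑ i ha hab).1

theorem localTime_sq_sub_le_timeChange_sub (hY : Measurable Y) (hϑ : ∀ i, 0 < ϑ i) (i : V)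
    {a b : ℝ} (ha : 0 ≤ a) (hab : a ≤ b) :
    localTime Y ϑ i b ^ 2 - localTime Y ϑ i a ^ 2 ≤ timeChange Y ϑ b - timeChange Y ϑ a := by
  rw [timeChange_sub]
  exact Finset.single_le_sum
    (f := fun i => localTime Y ϑ i b ^ 2 - localTime Y ϑ i a ^ 2)
    (fun j _ => (localTime_sq_sub_mem_Icc hY hϑ j ha hab).1) (Finset.mem_univ i)

theorem exists_lipschitzOnWith_timeChange (hY : Measurable Y) (hϑ : ∀ i, 0 < ϑ i) {T : ℝ}
    (hT : 0 ≤ T) : ∃ K, LipschitzOnWith K (timeChange Y ϑ) (Icc 0 T) := by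
  have hK : 0 ≤ ∑ i, 2 * (ϑ i + T) :=
    Finset.sum_nonneg fun i _ => by have := hϑ i; positivity
  refine ⟨NNReal.mk _ hK, lipschitzOnWith_of_increments fun a ha b hb hab =>
    ⟨sub_nonneg.2 (monotoneOn_timeChange hY hϑ ha.1 hb.1 hab), ?_⟩⟩
  rw [timeChange_sub, NNReal.coe_mk, Finset.sum_mul]
  refine Finset.sum_le_sum fun i _ => (localTime_sq_sub_mem_Icc hY hϑ i ha.1 hab).2.trans ?_
  have := hb.2
  exact mul_le_mul_of_nonneg_right (by linarith) (sub_nonneg.2 hab)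

end LocalTime

section Inverse

variable {D E : ℝ → ℝ}

theorem MonotoneOn.strictMonoOn_of_rightInverse (hD : MonotoneOn D (Ici 0))
    (hE : ∀ t, 0 ≤ t → 0 ≤ E t ∧ D (E t) = t) : StrictMonoOn E (Ici 0) := by
  intro a ha b hb hab
  by_contra! hle
  have h := hD (hE b hb).1 (hE a ha).1 hle
  rw [(hE b hb).2, (hE a ha).2] at h
  exact absurd hab h.not_gt

theorem MonotoneOn.continuousAt_inverse (hD : MonotoneOn D (Ici 0)) (hD0 : D 0 = 0)
    (hE : ∀ t, 0 ≤ t → 0 ≤ E t ∧ D (E t) = t) (hED : ∀ s, 0 ≤ s → E (D s) = s)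
    {t : ℝ} (ht : 0 < t) : ContinuousAt E t := by
  have hpos : 0 < E t := by
    refine (hE t ht.le).1.lt_of_ne fun h => ht.ne ?_
    rw [← (hE t ht.le).2, ← h, hD0]
  refine (hD.strictMonoOn_of_rightInverse hE).continuousAt_of_image_mem_nhds (Ici_mem_nhds ht)
    (mem_of_superset (Ici_mem_nhds hpos) fun s hs => ⟨D s, ?_, hED s hs⟩)
  rw [mem_Ici, ← hD0]
  exact hD self_mem_Ici hs hs

end Inverse

/-- **Local time identity for the time-changed process** (Statement 11).
If `D⁻¹ : [0,∞) → [0,∞)` is the inverse of the time change `D`, and `Z_t = Y_{D⁻¹(t)}`,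
then the local times of `Z` satisfy `∫₀^t 1{Z_τ = i} dτ = L_i(D⁻¹(t))² - ϑ_i²`. -/
theorem timeChanged_localTime {V : Type*} [Fintype V] [DecidableEq V] [Nonempty V]
    [MeasurableSpace V] [MeasurableSingletonClass V]
    (Y : ℝ → V) (hY : Measurable Y) (ϑ : V → ℝ) (hϑ : ∀ i, 0 < ϑ i)
    (Dinv : ℝ → ℝ)
    (hDinv_right : ∀ t : ℝ, 0 ≤ t → 0 ≤ Dinv t ∧ timeChange Y ϑ (Dinv t) = t)
    (hDinv_left : ∀ s : ℝ, 0 ≤ s → Dinv (timeChange Y ϑ s) = s) :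
    ∀ t : ℝ, 0 ≤ t → ∀ i : V,
      (∫ τ in (0 : ℝ)..t, (if Y (Dinv τ) = i then (1 : ℝ) else 0))
        = localTime Y ϑ i (Dinv t) ^ 2 - ϑ i ^ 2 := by
  intro t ht i
  have hmono := monotoneOn_timeChange hY hϑ
  have hDinv_mono := (hmono.strictMonoOn_of_rightInverse hDinv_right).monotoneOn
  have hDinv_zero : Dinv 0 = 0 := by
    simpa [timeChange_zero] using hDinv_left 0 le_rfl
  have hlip : LipschitzOnWith 1 (fun τ => localTime Y ϑ i (Dinv τ) ^ 2) (uIcc 0 t) := by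
    rw [uIcc_of_le ht]
    refine lipschitzOnWith_of_increments fun a ha b hb hab => ?_
    have hle := hDinv_mono ha.1 hb.1 hab
    refine ⟨(localTime_sq_sub_mem_Icc hY hϑ i (hDinv_right a ha.1).1 hle).1, ?_⟩
    have h := localTime_sq_sub_le_timeChange_sub hY hϑ i (hDinv_right a ha.1).1 hle
    rw [(hDinv_right a ha.1).2, (hDinv_right b hb.1).2] at h
    simpa using h
  have hftc := hlip.absolutelyContinuousOnInterval.integral_deriv_eq_sub
  rw [hDinv_zero, localTime_zero] at hftc
  rw [← hftc]
  obtain ⟨K, hK⟩ := exists_lipschitzOnWith_timeChange hY hϑ (hDinv_right t ht).1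
  let N : Set ℝ := {s | ¬ ∀ j, HasDerivAt (localTime Y ϑ j) (if Y s = j then 1 else 0) s}
  have hN : volume (N ∩ Icc 0 (Dinv t)) = 0 :=
    measure_mono_null inter_subset_left (ae_iff.1 (ae_forall_hasDerivAt_localTime hY ϑ))
  have hDN := (hK.mono inter_subset_right).volume_image_eq_zero hN
  refine intervalIntegral.integral_congr_ae ?_
  filter_upwards [measure_eq_zero_iff_ae_notMem.1 hDN] with τ hτ hτt
  rw [uIoc_of_le ht] at hτt
  obtain ⟨hpos, hτD⟩ := hDinv_right τ hτt.1.le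
  have hder : ∀ j, HasDerivAt (localTime Y ϑ j) (if Y (Dinv τ) = j then 1 else 0) (Dinv τ) := by
    by_contra hbad
    exact hτ ⟨Dinv τ, ⟨hbad, hpos, hDinv_mono hτt.1.le ht hτt.2⟩, hτD⟩
  have hL : 0 < localTime Y ϑ (Y (Dinv τ)) (Dinv τ) :=
    (hϑ _).trans_le (le_localTime hY _ hpos)
  have hinv : HasDerivAt Dinv (2 * localTime Y ϑ (Y (Dinv τ)) (Dinv τ))⁻¹ τ :=
    HasDerivAt.of_local_left_inverse
      (hmono.continuousAt_inverse timeChange_zero hDinv_right hDinv_left hτt.1)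
      (hasDerivAt_timeChange hder) (by positivity)
      ((eventually_gt_nhds hτt.1).mono fun y hy => (hDinv_right y hy.le).2)
  have hcomp : HasDerivAt (fun τ => localTime Y ϑ i (Dinv τ) ^ 2) _ τ :=
    ((hder i).comp τ hinv).fun_pow 2
  rw [hcomp.deriv]
  by_cases h : Y (Dinv τ) = i
  · subst h
    simp
    field_simp
  · simp [h]
end
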